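/- arXiv:math/0508245 — 3 statements merged into one kernel-verified Lean document; each statement's English description precedes it below -/
import Mathlib

section
/- Let μ be a Borel probability measure on ℝ and let n ≥ 2 be an integer. Then there exists a unique function Z in the class 𝓕 such that z = n·Z(z) − (n − 1)·F_μ(Z(z)) for all z ∈ ℂ⁺. -/
open MeasureTheory Complex Filter Set

/-- Open upper half-plane. -/
def upperHalf : Set ℂ := {z : ℂ | 0 < z.im}

/-- Cauchy transform of a Borel measure on ℝ. -/
noncomputable def cauchyG (μ : Measure ℝ) (z : ℂ) : ℂ := ∫ t, (z - (t : ℂ))⁻¹ ∂μ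

/-- Reciprocal Cauchy transform. -/
noncomputable def recF (μ : Measure ℝ) (z : ℂ) : ℂ := (cauchyG μ z)⁻¹

/-- The class 𝓕 of reciprocal Cauchy transforms of Borel probability measures on ℝ
(membership only depends on the values on the upper half-plane). -/
def classF (f : ℂ → ℂ) : Prop :=
  ∃ μ : Measure ℝ, IsProbabilityMeasure μ ∧ ∀ z ∈ upperHalf, f z = recF μ z


lemma sub_ofReal_ne {z : ℂ} (hz : 0 < z.im) (t : ℝ) : z - (t : ℂ) ≠ 0 := by
  intro h
  have := congrArg Complex.im h
  simp at this
  linarith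

lemma im_le_norm_sub {z : ℂ} (t : ℝ) : z.im ≤ ‖z - (t : ℂ)‖ := by
  have := Complex.abs_im_le_norm (z - (t : ℂ))
  simp at this
  exact (le_abs_self _).trans this

lemma norm_inv_sub_le {z : ℂ} (hz : 0 < z.im) (t : ℝ) : ‖(z - (t : ℂ))⁻¹‖ ≤ z.im⁻¹ := by
  rw [norm_inv]
  exact inv_anti₀ hz (im_le_norm_sub t)

lemma continuous_inv_sub {z : ℂ} (hz : 0 < z.im) :
    Continuous (fun t : ℝ => (z - (t : ℂ))⁻¹) :=
  Continuous.inv₀ (by fun_prop) (fun t => sub_ofReal_ne hz t)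

lemma integrable_inv_sub (μ : Measure ℝ) [IsProbabilityMeasure μ] {z : ℂ} (hz : 0 < z.im) :
    Integrable (fun t : ℝ => (z - (t : ℂ))⁻¹) μ :=
  Integrable.of_bound (continuous_inv_sub hz).aestronglyMeasurable z.im⁻¹
    (Eventually.of_forall (norm_inv_sub_le hz))

lemma norm_cauchyG_le (μ : Measure ℝ) [IsProbabilityMeasure μ] {z : ℂ} (hz : 0 < z.im) :
    ‖cauchyG μ z‖ ≤ z.im⁻¹ := by
  have := norm_integral_le_of_norm_le_const (μ := μ) (f := fun t : ℝ => (z - (t : ℂ))⁻¹)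
    (Eventually.of_forall (norm_inv_sub_le hz))
  simpa [cauchyG] using this

lemma integrable_sq (μ : Measure ℝ) [IsProbabilityMeasure μ] {z : ℂ} (hz : 0 < z.im) :
    Integrable (fun t : ℝ => ‖(z - (t : ℂ))⁻¹‖ ^ 2) μ := by
  refine Integrable.of_bound ((continuous_inv_sub hz).norm.pow 2).aestronglyMeasurable
    (z.im⁻¹ ^ 2) (Eventually.of_forall fun t => ?_)
  rw [Real.norm_of_nonneg (by positivity)]
  gcongr
  exact norm_inv_sub_le hz t

lemma im_inv_sub (z : ℂ) (t : ℝ) :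
    ((z - (t : ℂ))⁻¹).im = - z.im * ‖(z - (t : ℂ))⁻¹‖ ^ 2 := by
  rw [Complex.inv_im, norm_inv, Complex.normSq_eq_norm_sq]
  simp [div_eq_mul_inv]

lemma cauchyG_im (μ : Measure ℝ) [IsProbabilityMeasure μ] {z : ℂ} (hz : 0 < z.im) :
    (cauchyG μ z).im = - z.im * ∫ t : ℝ, ‖(z - (t : ℂ))⁻¹‖ ^ 2 ∂μ := by
  have h := integral_im (𝕜 := ℂ) (integrable_inv_sub μ hz)
  rw [cauchyG, ← integral_const_mul]
  change RCLike.im (∫ t : ℝ, (z - (t : ℂ))⁻¹ ∂μ) = _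
  rw [← h]
  refine integral_congr_ae (Eventually.of_forall fun t => ?_)
  exact im_inv_sub z t

lemma integral_sq_pos (μ : Measure ℝ) [IsProbabilityMeasure μ] {z : ℂ} (hz : 0 < z.im) :
    0 < ∫ t : ℝ, ‖(z - (t : ℂ))⁻¹‖ ^ 2 ∂μ := by
  rw [integral_pos_iff_support_of_nonneg (fun t => by positivity) (integrable_sq μ hz)]
  have : Function.support (fun t : ℝ => ‖(z - (t : ℂ))⁻¹‖ ^ 2) = Set.univ := by
    ext t
    simp [sub_ofReal_ne hz t]
  rw [this]
  simp

lemma cauchyG_im_neg (μ : Measure ℝ) [IsProbabilityMeasure μ] {z : ℂ} (hz : 0 < z.im) :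
    (cauchyG μ z).im < 0 := by
  rw [cauchyG_im μ hz]
  have := integral_sq_pos μ hz
  nlinarith [mul_pos hz this]

lemma cauchyG_ne (μ : Measure ℝ) [IsProbabilityMeasure μ] {z : ℂ} (hz : 0 < z.im) :
    cauchyG μ z ≠ 0 := by
  intro h
  have := cauchyG_im_neg μ hz
  rw [h] at this
  simp at this

/-- The function `h = F - id`. -/
noncomputable def hF (μ : Measure ℝ) (z : ℂ) : ℂ := recF μ z - z

/-- Normalized resolvent function with integral zero. -/
noncomputable def nrm (μ : Measure ℝ) (z : ℂ) (t : ℝ) : ℂ := (z - (t : ℂ))⁻¹ * recF μ z - 1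

lemma continuous_nrm (μ : Measure ℝ) {z : ℂ} (hz : 0 < z.im) : Continuous (nrm μ z) :=
  ((continuous_inv_sub hz).mul continuous_const).sub continuous_const

lemma nrm_bound (μ : Measure ℝ) {z : ℂ} (hz : 0 < z.im) (t : ℝ) :
    ‖nrm μ z t‖ ≤ z.im⁻¹ * ‖recF μ z‖ + 1 := by
  refine (norm_sub_le _ _).trans ?_
  rw [norm_mul, norm_one]
  gcongr
  exact norm_inv_sub_le hz t

lemma integral_f (μ : Measure ℝ) [IsProbabilityMeasure μ] {z : ℂ} (hz : 0 < z.im) :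
    ∫ t : ℝ, (z - (t : ℂ))⁻¹ * recF μ z ∂μ = 1 := by
  rw [integral_mul_const]
  exact mul_inv_cancel₀ (cauchyG_ne μ hz)

lemma integral_nrm_sq (μ : Measure ℝ) [IsProbabilityMeasure μ] {z : ℂ} (hz : 0 < z.im) :
    z.im * ∫ t, ‖nrm μ z t‖ ^ 2 ∂μ = (hF μ z).im := by
  have e : ∀ t : ℝ, ‖nrm μ z t‖ ^ 2 = ‖(z - (t : ℂ))⁻¹‖ ^ 2 * ‖recF μ z‖ ^ 2
      - 2 * ((z - (t : ℂ))⁻¹ * recF μ z).re + 1 := by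
    intro t
    rw [nrm, ← mul_pow, ← norm_mul, ← Complex.normSq_eq_norm_sq, ← Complex.normSq_eq_norm_sq,
      Complex.normSq_sub]
    simp
    ring
  have i1 : Integrable (fun t : ℝ => (z - (t : ℂ))⁻¹ * recF μ z) μ :=
    (integrable_inv_sub μ hz).mul_const _
  have i2 : Integrable (fun t : ℝ => ((z - (t : ℂ))⁻¹ * recF μ z).re) μ := i1.re
  have r : ∫ t : ℝ, ((z - (t : ℂ))⁻¹ * recF μ z).re ∂μ = 1 := by
    have := integral_re (𝕜 := ℂ) i1
    simp only [RCLike.re_eq_complex_re] at this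
    rw [this, integral_f μ hz]; simp
  simp_rw [e]
  have j1 : Integrable (fun t : ℝ => ‖(z - (t : ℂ))⁻¹‖ ^ 2 * ‖recF μ z‖ ^ 2) μ :=
    (integrable_sq μ hz).mul_const _
  have j2 : Integrable (fun t : ℝ => ‖(z - (t : ℂ))⁻¹‖ ^ 2 * ‖recF μ z‖ ^ 2
      - 2 * ((z - (t : ℂ))⁻¹ * recF μ z).re) μ := j1.sub (i2.const_mul 2)
  rw [integral_add j2 (integrable_const _),
    integral_sub j1 (i2.const_mul 2), integral_mul_const,
    integral_const_mul, r]
  have : (recF μ z).im = - (cauchyG μ z).im * ‖recF μ z‖ ^ 2 := by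
    rw [recF, Complex.inv_im, norm_inv, Complex.normSq_eq_norm_sq, inv_pow, div_eq_mul_inv]
  rw [hF, Complex.sub_im, this, cauchyG_im μ hz]
  simp
  ring

lemma integral_nrm_mul (μ : Measure ℝ) [IsProbabilityMeasure μ] {z w : ℂ} (hz : 0 < z.im)
    (hw : 0 < w.im) :
    (z - w) * ∫ t, nrm μ z t * nrm μ w t ∂μ = hF μ z - hF μ w := by
  have i1 : Integrable (fun t : ℝ => (z - (t : ℂ))⁻¹) μ := integrable_inv_sub μ hz
  have i2 : Integrable (fun t : ℝ => (w - (t : ℂ))⁻¹) μ := integrable_inv_sub μ hw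
  have e : ∀ t : ℝ, (z - w) * (nrm μ z t * nrm μ w t) =
     recF μ z * recF μ w * ((w - (t : ℂ))⁻¹ - (z - (t : ℂ))⁻¹) -
     (z - w) * ((z - (t : ℂ))⁻¹ * recF μ z) - (z - w) * ((w - (t : ℂ))⁻¹ * recF μ w) + (z - w) := by
    intro t
    have h1 := sub_ofReal_ne hz t
    have h2 := sub_ofReal_ne hw t
    rw [nrm, nrm]
    field_simp
    ring
  rw [← integral_const_mul]
  simp_rw [e]
  have j1 : Integrable (fun t : ℝ => recF μ z * recF μ w * ((w - (t : ℂ))⁻¹ - (z - (t : ℂ))⁻¹)) μ :=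
    (i2.sub i1).const_mul _
  have j2 : Integrable (fun t : ℝ => (z - w) * ((z - (t : ℂ))⁻¹ * recF μ z)) μ :=
    (i1.mul_const _).const_mul _
  have j3 : Integrable (fun t : ℝ => (z - w) * ((w - (t : ℂ))⁻¹ * recF μ w)) μ :=
    (i2.mul_const _).const_mul _
  have j4 : Integrable (fun t : ℝ => recF μ z * recF μ w * ((w - (t : ℂ))⁻¹ - (z - (t : ℂ))⁻¹) -
     (z - w) * ((z - (t : ℂ))⁻¹ * recF μ z)) μ := j1.sub j2
  have j5 : Integrable (fun t : ℝ => recF μ z * recF μ w * ((w - (t : ℂ))⁻¹ - (z - (t : ℂ))⁻¹) -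
     (z - w) * ((z - (t : ℂ))⁻¹ * recF μ z) - (z - w) * ((w - (t : ℂ))⁻¹ * recF μ w)) μ := j4.sub j3
  rw [integral_add j5 (integrable_const _), integral_sub j4 j3, integral_sub j1 j2,
    integral_const_mul, integral_const_mul, integral_const_mul, integral_f μ hz, integral_f μ hw,
    integral_sub i2 i1]
  change recF μ z * recF μ w * (cauchyG μ w - cauchyG μ z) - _ - _ + _ = _
  have h1 := cauchyG_ne μ hz
  have h2 := cauchyG_ne μ hw
  simp [hF, recF]
  field_simp
  ring

lemma hF_im_nonneg (μ : Measure ℝ) [IsProbabilityMeasure μ] {z : ℂ} (hz : 0 < z.im) :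
    0 ≤ (hF μ z).im := by
  rw [← integral_nrm_sq μ hz]
  exact mul_nonneg hz.le (integral_nonneg fun t => by positivity)

lemma cs (μ : Measure ℝ) [IsProbabilityMeasure μ] (f g : ℝ → ℂ) (hf : Continuous f)
    (hg : Continuous g) (A B : ℝ) (hA : ∀ t, ‖f t‖ ≤ A) (hB : ∀ t, ‖g t‖ ≤ B) :
    ‖∫ t, f t * g t ∂μ‖ ^ 2 ≤ (∫ t, ‖f t‖ ^ 2 ∂μ) * ∫ t, ‖g t‖ ^ 2 ∂μ := by
  have mf : MemLp f (ENNReal.ofReal 2) μ :=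
    MemLp.of_bound hf.aestronglyMeasurable A (Eventually.of_forall hA)
  have mg : MemLp g (ENNReal.ofReal 2) μ :=
    MemLp.of_bound hg.aestronglyMeasurable B (Eventually.of_forall hB)
  have h := integral_mul_norm_le_Lp_mul_Lq (μ := μ) Real.HolderConjugate.two_two mf mg
  have h0 : ‖∫ t, f t * g t ∂μ‖ ≤ ∫ t, ‖f t‖ * ‖g t‖ ∂μ := by
    refine (norm_integral_le_integral_norm _).trans (le_of_eq ?_)
    simp
  have h1 := h0.trans h
  simp only [Real.rpow_ofNat, ← Real.sqrt_eq_rpow] at h1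
  calc _ ≤ (√(∫ t, ‖f t‖ ^ 2 ∂μ) * √(∫ t, ‖g t‖ ^ 2 ∂μ)) ^ 2 := by gcongr
    _ = _ := by
      rw [mul_pow, Real.sq_sqrt, Real.sq_sqrt] <;> exact integral_nonneg fun t => by positivity

/-- Pick inequality. -/
lemma pick (μ : Measure ℝ) [IsProbabilityMeasure μ] {z w : ℂ} (hz : 0 < z.im)
    (hw : 0 < w.im) :
    ‖hF μ z - hF μ w‖ ^ 2 * (z.im * w.im) ≤ ‖z - w‖ ^ 2 * ((hF μ z).im * (hF μ w).im) := by
  rw [← integral_nrm_mul μ hz hw, ← integral_nrm_sq μ hz, ← integral_nrm_sq μ hw, norm_mul, mul_pow]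
  have := cs μ _ _ (continuous_nrm μ hz) (continuous_nrm μ hw) _ _ (nrm_bound μ hz) (nrm_bound μ hw)
  have h2 := mul_le_mul_of_nonneg_left this
    (show 0 ≤ ‖z - w‖ ^ 2 * (z.im * w.im) by positivity)
  nlinarith [h2]

lemma cauchyG_differentiableOn (μ : Measure ℝ) [IsProbabilityMeasure μ] :
    DifferentiableOn ℂ (cauchyG μ) upperHalf := by
  intro z hz
  have hz' : 0 < z.im := hz
  have hs : {w : ℂ | z.im / 2 < w.im} ∈ nhds z :=
    (isOpen_lt continuous_const Complex.continuous_im).mem_nhds (by simp; linarith)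
  have := hasDerivAt_integral_of_dominated_loc_of_deriv_le (μ := μ) (𝕜 := ℂ)
    (F := fun (w : ℂ) (t : ℝ) => (w - (t : ℂ))⁻¹)
    (F' := fun (w : ℂ) (t : ℝ) => - ((w - (t : ℂ)) ^ 2)⁻¹) (x₀ := z)
    (s := {w : ℂ | z.im / 2 < w.im}) (bound := fun _ => ((z.im / 2) ^ 2)⁻¹) hs
    (by
      filter_upwards [hs] with w hw
      exact (continuous_inv_sub (lt_trans (by linarith) hw)).aestronglyMeasurable)
    (integrable_inv_sub μ hz')
    (Continuous.aestronglyMeasurable (Continuous.neg (Continuous.inv₀ (by fun_prop)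
      (fun t => pow_ne_zero 2 (sub_ofReal_ne hz' t)))))
    (Eventually.of_forall fun t w hw => by
      replace hw : z.im / 2 < w.im := hw
      rw [norm_neg, norm_inv, norm_pow]
      have := im_le_norm_sub (z := w) t
      gcongr
      linarith)
    (integrable_const _)
    (Eventually.of_forall fun t w hw => by
      replace hw : z.im / 2 < w.im := hw
      have h : HasDerivAt (fun w : ℂ => (w - (t : ℂ))⁻¹) (-1 / (w - (t : ℂ)) ^ 2) w :=
        ((hasDerivAt_id w).sub_const (t : ℂ)).inv
        (sub_ofReal_ne (z := w) (by linarith) t)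
      rwa [neg_div, one_div] at h)
  exact this.2.differentiableAt.differentiableWithinAt

lemma hF_differentiableOn (μ : Measure ℝ) [IsProbabilityMeasure μ] :
    DifferentiableOn ℂ (hF μ) upperHalf :=
  ((cauchyG_differentiableOn μ).inv fun _ hz => cauchyG_ne μ hz).sub differentiableOn_id

lemma tail_bound (ν : Measure ℝ) [IsProbabilityMeasure ν] {y δ : ℝ} (hy : 0 < y)
    (h : ‖1 - ((y : ℂ) * I) * cauchyG ν ((y : ℂ) * I)‖ ≤ δ) :
    ν (Icc (-y) y)ᶜ ≤ ENNReal.ofReal (2 * δ) := by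
  have him : ((y : ℂ) * I).im = y := by simp
  have hz : 0 < ((y : ℂ) * I).im := by rw [him]; exact hy
  have h1 : 1 - y ^ 2 * ∫ t : ℝ, ‖((y : ℂ) * I - (t : ℂ))⁻¹‖ ^ 2 ∂ν ≤ δ := by
    refine le_trans (le_trans (le_of_eq ?_) (Complex.re_le_norm _)) h
    simp only [Complex.sub_re, Complex.one_re, Complex.mul_re, Complex.mul_im, Complex.ofReal_re,
      Complex.ofReal_im, Complex.I_re, Complex.I_im]
    rw [cauchyG_im ν hz, him]
    ring
  have hm : MeasurableSet (Icc (-y) y)ᶜ := measurableSet_Icc.compl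
  have h2 : y ^ 2 * ∫ t : ℝ, ‖((y : ℂ) * I - (t : ℂ))⁻¹‖ ^ 2 ∂ν ≤
      ∫ t : ℝ, (1 - 2⁻¹ * (Icc (-y) y)ᶜ.indicator (fun _ => (1:ℝ)) t) ∂ν := by
    rw [← integral_const_mul]
    refine integral_mono ((integrable_sq ν hz).const_mul _)
      ((integrable_const _).sub (((integrable_const _).indicator hm).const_mul _)) (fun t => ?_)
    have e : ‖((y : ℂ) * I - (t : ℂ))⁻¹‖ ^ 2 = (t ^ 2 + y ^ 2)⁻¹ := by
      rw [norm_inv, inv_pow, ← Complex.normSq_eq_norm_sq, Complex.normSq_apply]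
      simp; ring
    simp only [e]
    have hp : 0 < t ^ 2 + y ^ 2 := by positivity
    by_cases ht : t ∈ (Icc (-y) y)ᶜ
    · rw [indicator_of_mem ht, ← div_eq_mul_inv, div_le_iff₀ hp]
      have : ¬ |t| ≤ y := by rw [abs_le]; exact ht
      have : y ^ 2 ≤ t ^ 2 := by
        rw [← sq_abs t]; gcongr; exact (not_le.1 this).le
      linarith
    · rw [indicator_of_notMem ht, ← div_eq_mul_inv, div_le_iff₀ hp]
      nlinarith [sq_nonneg t]
  rw [integral_sub (integrable_const _) (((integrable_const _).indicator hm).const_mul _),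
    integral_const_mul, integral_indicator hm] at h2
  simp only [integral_const, probReal_univ, smul_eq_mul, mul_one, measureReal_restrict_apply_univ] at h2
  rw [← ofReal_measureReal]
  apply ENNReal.ofReal_le_ofReal
  linarith

lemma compact_lim (ν : ℕ → Measure ℝ) (hν : ∀ k, IsProbabilityMeasure (ν k)) (g : ℂ → ℂ)
    (ht : ∀ δ > 0, ∃ y : ℝ, 0 < y ∧
      ∀ k, ‖1 - ((y : ℂ) * I) * cauchyG (ν k) ((y : ℂ) * I)‖ ≤ δ)
    (hlim : ∀ z : ℂ, 0 < z.im → Tendsto (fun k => cauchyG (ν k) z) atTop (nhds (g z))) :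
    ∃ ρ : Measure ℝ, IsProbabilityMeasure ρ ∧ ∀ z : ℂ, 0 < z.im → cauchyG ρ z = g z := by
  let P : ℕ → ProbabilityMeasure ℝ := fun k => ⟨ν k, hν k⟩
  have hT : IsTightMeasureSet {((μ : ProbabilityMeasure ℝ) : Measure ℝ) | μ ∈ range P} := by
    rw [isTightMeasureSet_iff_exists_isCompact_measure_compl_le]
    intro ε hε
    obtain ⟨δ, hδ, hδε⟩ : ∃ δ : ℝ, 0 < δ ∧ ENNReal.ofReal (2 * δ) ≤ ε := by
      rcases eq_or_ne ε ⊤ with rfl | hne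
      · exact ⟨1, one_pos, le_top⟩
      · refine ⟨ε.toReal / 2, half_pos (ENNReal.toReal_pos hε.ne' hne), ?_⟩
        rw [mul_div_cancel₀ _ two_ne_zero, ENNReal.ofReal_toReal hne]
    obtain ⟨y, hy, hk⟩ := ht δ hδ
    refine ⟨Icc (-y) y, isCompact_Icc, ?_⟩
    rintro _ ⟨_, ⟨k, rfl⟩, rfl⟩
    exact (tail_bound (ν k) hy (hk k)).trans hδε
  have hc := isCompact_closure_of_isTightMeasureSet hT
  obtain ⟨ρ, -, hρ⟩ := hc.exists_mapClusterPt (f := atTop) (u := P)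
    (le_principal_iff.2 (mem_map.2 (Eventually.of_forall fun k =>
      subset_closure (s := range P) (mem_range_self k))))
  refine ⟨(ρ : Measure ℝ), inferInstance, fun z hz => ?_⟩
  let f : BoundedContinuousFunction ℝ ℂ :=
    BoundedContinuousFunction.ofNormedAddCommGroup (fun t : ℝ => (z - (t : ℂ))⁻¹)
      (continuous_inv_sub hz) z.im⁻¹ (norm_inv_sub_le hz)
  have hcont : ContinuousAt (fun Q : ProbabilityMeasure ℝ => cauchyG (Q : Measure ℝ) z) ρ :=
    (ProbabilityMeasure.tendsto_iff_forall_integral_rclike_tendsto ℂ).1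
      (tendsto_id (x := nhds ρ)) f
  have h1 : MapClusterPt (cauchyG (ρ : Measure ℝ) z) atTop (fun k => cauchyG (ν k) z) :=
    hρ.continuousAt_comp hcont
  have h2 : ClusterPt (cauchyG (ρ : Measure ℝ) z) (nhds (g z)) := ClusterPt.mono h1 (hlim z hz)
  exact eq_of_nhds_neBot h2

/-- Cone estimate: `h(w) = o(|w|)` nontangentially. -/
lemma cone (μ : Measure ℝ) [IsProbabilityMeasure μ] {δ : ℝ} (hδ : 0 < δ) :
    ∃ Y : ℝ, 0 < Y ∧ ∀ y ≥ Y, ∀ w : ℂ, ‖w - (y : ℂ) * I‖ ≤ y / 2 → ‖hF μ w‖ ≤ δ * y := by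
  have hlim : Tendsto (fun y : ℝ => ∫ t : ℝ, min 4 (2 * |t| / y) ∂μ) atTop
      (nhds (∫ t : ℝ, (0:ℝ) ∂μ)) := by
    apply tendsto_integral_filter_of_dominated_convergence (fun _ => (4:ℝ))
    · exact Eventually.of_forall fun y => Continuous.aestronglyMeasurable (by fun_prop)
    · filter_upwards [eventually_gt_atTop 0] with y hy
      refine Eventually.of_forall fun t => ?_
      rw [Real.norm_of_nonneg (by positivity)]
      exact min_le_left _ _
    · exact integrable_const _
    · refine Eventually.of_forall fun t => ?_
      have : Tendsto (fun y : ℝ => 2 * |t| / y) atTop (nhds 0) :=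
        tendsto_const_nhds.div_atTop tendsto_id
      have h2 := (tendsto_const_nhds (x := (4:ℝ))).min this
      simpa using h2
  simp only [integral_zero] at hlim
  set η : ℝ := min 2⁻¹ (δ / 3) with hη
  have hη0 : 0 < η := by positivity
  have ev : ∀ᶠ y : ℝ in atTop, ∫ t : ℝ, min 4 (2 * |t| / y) ∂μ < η :=
    hlim.eventually (gt_mem_nhds hη0)
  obtain ⟨Y, hY⟩ := eventually_atTop.1 ev
  refine ⟨max Y 1, by positivity, fun y hy w hw => ?_⟩
  have hy0 : 0 < y := lt_of_lt_of_le (by positivity) hy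
  have hYy := hY y ((le_max_left _ _).trans hy)
  have him : y / 2 ≤ w.im := by
    have := (Complex.abs_im_le_norm (w - (y : ℂ) * I)).trans hw
    simp at this
    have := (abs_le.1 this).1
    linarith
  have hw0 : 0 < w.im := by linarith
  have hwn : ‖w‖ ≤ 3 * y / 2 := by
    have : ‖w‖ ≤ ‖w - (y : ℂ) * I‖ + ‖(y : ℂ) * I‖ := norm_le_norm_sub_add _ _
    simp [abs_of_pos hy0] at this
    linarith
  have key : ‖w * cauchyG μ w - 1‖ ≤ η := by
    have e : w * cauchyG μ w - 1 = ∫ t : ℝ, (w * (w - (t : ℂ))⁻¹ - 1) ∂μ := by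
      rw [integral_sub ((integrable_inv_sub μ hw0).const_mul _) (integrable_const _),
        integral_const_mul]
      simp [cauchyG]
    rw [e]
    refine (norm_integral_le_of_norm_le (g := fun t : ℝ => min 4 (2 * |t| / y)) ?_ ?_).trans hYy.le
    · refine Integrable.of_bound (Continuous.aestronglyMeasurable (by fun_prop)) 4
        (Eventually.of_forall fun t => ?_)
      rw [Real.norm_of_nonneg (by positivity)]
      exact min_le_left _ _
    · refine Eventually.of_forall fun t => ?_
      have hne := sub_ofReal_ne hw0 t
      have e2 : w * (w - (t : ℂ))⁻¹ - 1 = t / (w - (t : ℂ)) := by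
        field_simp; ring
      have h3 := im_le_norm_sub (z := w) t
      have hpos : 0 < ‖w - (t : ℂ)‖ := norm_pos_iff.2 hne
      rw [e2, norm_div, Complex.norm_real, Real.norm_eq_abs]
      refine le_min ?_ ?_
      · rw [div_le_iff₀ hpos]
        have h4 : |t| ≤ ‖w - (t : ℂ)‖ + ‖w‖ := by
          have := norm_sub_le w (w - (t : ℂ))
          rw [sub_sub_cancel, Complex.norm_real, Real.norm_eq_abs] at this
          linarith
        linarith
      · rw [div_le_div_iff₀ hpos hy0]
        nlinarith [abs_nonneg t]
  have hG := cauchyG_ne μ hw0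
  have hwne : w ≠ 0 := by rintro rfl; simp at hw0
  have hlow : 2⁻¹ ≤ ‖w * cauchyG μ w‖ := by
    have := norm_sub_norm_le 1 (w * cauchyG μ w)
    rw [norm_sub_rev, norm_one] at this
    have : η ≤ 2⁻¹ := min_le_left _ _
    linarith
  have e : hF μ w * (w * cauchyG μ w) = - w * (w * cauchyG μ w - 1) := by
    rw [hF, recF]; field_simp; ring
  have e2 := congrArg norm e
  rw [norm_mul, norm_mul (-w), norm_neg] at e2
  have hη3 : η ≤ δ / 3 := min_le_right _ _
  have u : ‖w‖ * ‖w * cauchyG μ w - 1‖ ≤ (3 * y / 2) * (δ / 3) := by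
    gcongr
    exact key.trans hη3
  nlinarith [norm_nonneg (hF μ w)]

lemma normSub_sq_eq (z : ℂ) (t : ℝ) : ‖z - (t : ℂ)‖ ^ 2 = (t - z.re) ^ 2 + z.im ^ 2 := by
  rw [← Complex.normSq_eq_norm_sq, Complex.normSq_apply]
  simp; ring

lemma ker_eq {z : ℂ} (hz : 0 < z.im) (t : ℝ) :
    (‖z - (t : ℂ)‖ ^ 2)⁻¹ = (z.im ^ 2)⁻¹ * (1 + ((t - z.re) / z.im) ^ 2)⁻¹ := by
  rw [normSub_sq_eq]
  have := hz.ne'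
  rw [← mul_inv]
  congr 1
  field_simp
  ring

lemma ker_integrable {z : ℂ} (hz : 0 < z.im) :
    Integrable (fun t : ℝ => (‖z - (t : ℂ)‖ ^ 2)⁻¹) := by
  simp_rw [ker_eq hz]
  exact ((integrable_inv_one_add_sq.comp_div hz.ne').comp_sub_right z.re).const_mul _

lemma ker_integral {z : ℂ} (hz : 0 < z.im) :
    ∫ t : ℝ, (‖z - (t : ℂ)‖ ^ 2)⁻¹ = Real.pi / z.im := by
  simp_rw [ker_eq hz]
  rw [integral_const_mul,
    integral_sub_right_eq_self (fun t : ℝ => (1 + (t / z.im) ^ 2)⁻¹) z.re,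
    Measure.integral_comp_div (fun t : ℝ => (1 + t ^ 2)⁻¹) z.im, integral_univ_inv_one_add_sq,
    abs_of_pos hz, smul_eq_mul]
  have := hz.ne'
  field_simp

lemma poisson_aux (g : ℂ → ℂ) {ε M : ℝ} (hε : 0 < ε)
    (hd : DifferentiableOn ℂ g {w : ℂ | -ε < w.im}) (hM : ∀ w : ℂ, 0 ≤ w.im → ‖g w‖ ≤ M)
    {z : ℂ} (hz : 0 < z.im) :
    ∫ t : ℝ, (g t - g z) * (((‖z - (t : ℂ)‖ ^ 2)⁻¹ : ℝ) : ℂ) = 0 := by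
  have hM0 : 0 ≤ M := (norm_nonneg _).trans (hM z hz.le)
  let q : ℂ → ℂ := fun w => dslope g z w * (w - (starRingEnd ℂ) z)⁻¹
  have hq : ∀ w : ℂ, w ≠ z → q w = (g w - g z) * ((w - z)⁻¹ * (w - (starRingEnd ℂ) z)⁻¹) := by
    intro w hw
    simp only [q]
    rw [dslope_of_ne _ hw, slope_def_field, div_eq_mul_inv, mul_assoc]
  have hqt : ∀ t : ℝ, q t = (g t - g z) * (((‖z - (t : ℂ)‖ ^ 2)⁻¹ : ℝ) : ℂ) := by
    intro t
    rw [hq t (fun h => sub_ofReal_ne hz t (by rw [h, sub_self])), ← mul_inv]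
    congr 1
    push_cast
    congr 1
    rw [← Complex.mul_conj']
    simp
    ring
  have hqn : ∀ R : ℝ, 2 * ‖z‖ < R → ∀ w : ℂ, 0 ≤ w.im → R ≤ ‖w‖ → ‖q w‖ ≤ 8 * M / R ^ 2 := by
    intro R hR w hw hRw
    have hR0 : 0 < R := lt_of_le_of_lt (by positivity) hR
    have h1 : R / 2 ≤ ‖w - z‖ := by
      have := norm_sub_norm_le w z
      linarith
    have h2 : R / 2 ≤ ‖w - (starRingEnd ℂ) z‖ := by
      have := norm_sub_norm_le w ((starRingEnd ℂ) z)
      rw [Complex.norm_conj] at this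
      linarith
    have hne : w ≠ z := by
      rintro rfl
      simp at h1
      linarith
    rw [hq w hne, norm_mul, norm_mul, norm_inv, norm_inv]
    have h3 : ‖g w - g z‖ ≤ 2 * M := by
      have := norm_sub_le (g w) (g z)
      have := hM w hw
      have := hM z hz.le
      linarith
    calc _ ≤ (2 * M) * ((R / 2)⁻¹ * (R / 2)⁻¹) := by gcongr
      _ = _ := by field_simp; ring
  have hqd : DifferentiableOn ℂ q {w : ℂ | -(min ε z.im) < w.im} := by
    refine DifferentiableOn.mul ?_ ?_
    · refine ((Complex.differentiableOn_dslope ?_).2 hd).mono ?_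
      · exact (isOpen_lt continuous_const Complex.continuous_im).mem_nhds
          (show -ε < z.im by linarith)
      · intro w hw
        have hw' : -(min ε z.im) < w.im := hw
        have := min_le_left ε z.im
        exact lt_of_le_of_lt (by linarith) hw'
    · refine DifferentiableOn.inv (by fun_prop) ?_
      intro w hw h
      have hw' : -(min ε z.im) < w.im := hw
      have := min_le_right ε z.im
      have h2 := congrArg Complex.im h
      simp at h2
      linarith
  have hmin : 0 < min ε z.im := lt_min hε hz
  have hqi : Integrable (fun t : ℝ => q t) := by
    refine Integrable.mono' ((ker_integrable hz).const_mul (2 * M)) ?_ ?_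
    · refine Continuous.aestronglyMeasurable ?_
      refine hqd.continuousOn.comp_continuous Complex.continuous_ofReal (fun t => ?_)
      change -(min ε z.im) < ((t : ℂ)).im
      simpa using ⟨hε, hz⟩
    · refine Eventually.of_forall fun t => ?_
      rw [hqt, norm_mul, Complex.norm_real, Real.norm_of_nonneg (by positivity)]
      gcongr
      have := norm_sub_le (g t) (g z)
      have := hM t (by simp)
      have := hM z hz.le
      linarith
  have hlim := intervalIntegral_tendsto_integral hqi tendsto_neg_atTop_atBot
    (tendsto_id (α := ℝ) (x := atTop))
  have hlim0 : Tendsto (fun R : ℝ => ∫ t in (-R)..(id R), q t) atTop (nhds 0) := by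
    apply squeeze_zero_norm' (a := fun R : ℝ => 32 * M / R)
    · filter_upwards [eventually_gt_atTop (2 * ‖z‖), eventually_gt_atTop 0] with R hR hR0
      have rect := Complex.integral_boundary_rect_eq_zero_of_differentiableOn q
        (⟨-R, 0⟩ : ℂ) (⟨R, R⟩ : ℂ) (hqd.mono (by
          intro w hw
          have : w.im ∈ uIcc (0:ℝ) R := hw.2
          rw [uIcc_of_le hR0.le] at this
          exact lt_of_lt_of_le (by linarith) this.1))
      simp only [Complex.ofReal_zero, zero_mul, add_zero, smul_eq_mul] at rect
      have b1 : ‖∫ x : ℝ in (-R)..R, q (x + R * I)‖ ≤ 8 * M / R ^ 2 * |R - (-R)| := by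
        refine intervalIntegral.norm_integral_le_of_norm_le_const fun x hx => ?_
        refine hqn R hR _ (by simpa using hR0.le) ?_
        have := Complex.abs_im_le_norm ((x : ℂ) + R * I)
        simp at this
        exact (le_abs_self R).trans this
      have b2 : ‖∫ y : ℝ in (0:ℝ)..R, q ((R : ℝ) + y * I)‖ ≤ 8 * M / R ^ 2 * |R - 0| := by
        refine intervalIntegral.norm_integral_le_of_norm_le_const fun x hx => ?_
        rw [uIoc_of_le hR0.le] at hx
        refine hqn R hR _ (by simpa using hx.1.le) ?_
        have := Complex.abs_re_le_norm ((R : ℂ) + x * I)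
        simp at this
        exact (le_abs_self R).trans this
      have b3 : ‖∫ y : ℝ in (0:ℝ)..R, q ((-R : ℝ) + y * I)‖ ≤ 8 * M / R ^ 2 * |R - 0| := by
        refine intervalIntegral.norm_integral_le_of_norm_le_const fun x hx => ?_
        rw [uIoc_of_le hR0.le] at hx
        refine hqn R hR _ (by simpa using hx.1.le) ?_
        have := Complex.abs_re_le_norm (((-R : ℝ) : ℂ) + x * I)
        simp at this
        exact (le_abs_self R).trans (by simpa using this)
      have e : ∫ t in (-R)..(id R), q t = (∫ x : ℝ in (-R)..R, q (x + R * I))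
          - I * (∫ y : ℝ in (0:ℝ)..R, q ((R : ℝ) + y * I))
          + I * (∫ y : ℝ in (0:ℝ)..R, q ((-R : ℝ) + y * I)) := by
        simp only [id]
        linear_combination rect
      rw [e]
      refine (norm_add_le _ _).trans ?_
      refine (add_le_add (norm_sub_le _ _) le_rfl).trans ?_
      rw [norm_mul, norm_mul, Complex.norm_I, one_mul, one_mul]
      refine (add_le_add (add_le_add b1 b2) b3).trans (le_of_eq ?_)
      rw [sub_zero, sub_neg_eq_add, abs_of_pos hR0, abs_of_pos (by linarith)]
      field_simp
      ring
    · exact tendsto_const_nhds.div_atTop tendsto_id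
  have := tendsto_nhds_unique hlim hlim0
  simpa only [hqt] using this

lemma poisson (g : ℂ → ℂ) {ε M : ℝ} (hε : 0 < ε)
    (hd : DifferentiableOn ℂ g {w : ℂ | -ε < w.im}) (hM : ∀ w : ℂ, 0 ≤ w.im → ‖g w‖ ≤ M)
    {z : ℂ} (hz : 0 < z.im) :
    ∫ t : ℝ, (g t).im * (‖z - (t : ℂ)‖ ^ 2)⁻¹ = (g z).im * (Real.pi / z.im) := by
  have h := poisson_aux g hε hd hM hz
  have hc : Continuous (fun t : ℝ => g t) :=
    hd.continuousOn.comp_continuous Complex.continuous_ofReal (fun t => by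
      change -ε < ((t : ℂ)).im
      simpa using hε)
  have i1 : Integrable (fun t : ℝ => (g t - g z) * (((‖z - (t : ℂ)‖ ^ 2)⁻¹ : ℝ) : ℂ)) := by
    refine Integrable.bdd_mul (c := M + M) (ker_integrable hz).ofReal
      (hc.sub continuous_const).aestronglyMeasurable (Eventually.of_forall fun t => ?_)
    exact (norm_sub_le _ _).trans (add_le_add (hM t (by simp)) (hM z hz.le))
  have him := integral_im (𝕜 := ℂ) i1
  rw [h] at him
  simp only [RCLike.im_eq_complex_im, Complex.im_mul_ofReal, Complex.sub_im, sub_mul,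
    Complex.zero_im] at him
  have j1 : Integrable (fun t : ℝ => (g t).im * (‖z - (t : ℂ)‖ ^ 2)⁻¹) := by
    refine Integrable.bdd_mul (c := M) (ker_integrable hz)
      (Complex.continuous_im.comp hc).aestronglyMeasurable (Eventually.of_forall fun t => ?_)
    exact (Complex.abs_im_le_norm _).trans (hM t (by simp))
  rw [integral_sub j1 ((ker_integrable hz).const_mul _), integral_const_mul, ker_integral hz] at him
  linarith

lemma isConnected_upperHalf : IsConnected upperHalf := by
  refine ⟨⟨I, by simp [upperHalf]⟩, ?_⟩
  exact (convex_halfSpace_im_gt 0).isPreconnected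

lemma isOpen_upperHalf : IsOpen upperHalf :=
  isOpen_lt continuous_const Complex.continuous_im

lemma nev_shift (g : ℂ → ℂ) {ε M : ℝ} (hε : 0 < ε)
    (hd : DifferentiableOn ℂ g {w : ℂ | -ε < w.im}) (hM : ∀ w : ℂ, 0 ≤ w.im → ‖g w‖ ≤ M)
    (hneg : ∀ w : ℂ, 0 ≤ w.im → (g w).im ≤ 0)
    (hb : ∀ w : ℂ, 0 < w.im → ‖g w‖ ≤ w.im⁻¹)
    (hlim : Tendsto (fun y : ℝ => ((y : ℂ) * I) * g ((y : ℂ) * I)) atTop (nhds 1)) :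
    ∃ ρ : Measure ℝ, IsProbabilityMeasure ρ ∧ ∀ z : ℂ, 0 < z.im → cauchyG ρ z = g z := by
  have hc : Continuous (fun t : ℝ => g t) :=
    hd.continuousOn.comp_continuous Complex.continuous_ofReal (fun t => by
      change -ε < ((t : ℂ)).im
      simpa using hε)
  let r : ℝ → ℝ := fun t => - (g t).im / Real.pi
  have hrc : Continuous r := by
    have := Complex.continuous_im.comp hc
    exact (this.neg).div_const _
  have hr0 : ∀ t, 0 ≤ r t := fun t =>
    div_nonneg (neg_nonneg.2 (hneg t (by simp))) Real.pi_pos.le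
  have hP : ∀ z : ℂ, 0 < z.im → ∫ t : ℝ, r t * (‖z - (t : ℂ)‖ ^ 2)⁻¹ = - (g z).im / z.im := by
    intro z hz
    have e : ∀ t : ℝ, r t * (‖z - (t : ℂ)‖ ^ 2)⁻¹ =
        (-1 / Real.pi) * ((g t).im * (‖z - (t : ℂ)‖ ^ 2)⁻¹) := by
      intro t; simp only [r]; ring
    simp_rw [e]
    rw [integral_const_mul, poisson g hε hd hM hz]
    have := Real.pi_ne_zero
    field_simp
  have hI : ∀ z : ℂ, 0 < z.im → Integrable (fun t : ℝ => r t * (‖z - (t : ℂ)‖ ^ 2)⁻¹) := by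
    intro z hz
    refine Integrable.bdd_mul (c := M / Real.pi) (ker_integrable hz)
      hrc.aestronglyMeasurable (Eventually.of_forall fun t => ?_)
    rw [Real.norm_of_nonneg (hr0 t)]
    simp only [r]
    have := (neg_le_abs _).trans ((Complex.abs_im_le_norm (g t)).trans (hM t (by simp)))
    have := Real.pi_pos
    gcongr
  let d : ℝ → ENNReal := fun t => ENNReal.ofReal (r t)
  have hdm : Measurable d := hrc.measurable.ennreal_ofReal
  -- total mass
  have hmass : ∫⁻ t, d t = 1 := by
    have m1 : Tendsto (fun k : ℕ => ∫⁻ t : ℝ, ENNReal.ofReal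
        (((k : ℝ) + 1) ^ 2 * (r t * (‖(((k : ℝ) + 1 : ℝ) : ℂ) * I - (t : ℂ)‖ ^ 2)⁻¹)))
        atTop (nhds (∫⁻ t, d t)) := by
      have en : ∀ (k : ℕ) (t : ℝ), ((k : ℝ) + 1) ^ 2 *
          (r t * (‖(((k : ℝ) + 1 : ℝ) : ℂ) * I - (t : ℂ)‖ ^ 2)⁻¹)
          = r t * (1 + (t / ((k : ℝ) + 1)) ^ 2)⁻¹ := by
        intro k t
        have hk : (0 : ℝ) < (k : ℝ) + 1 := by positivity
        have him : ((((k : ℝ) + 1 : ℝ) : ℂ) * I).im = (k : ℝ) + 1 := by simp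
        have hre : ((((k : ℝ) + 1 : ℝ) : ℂ) * I).re = 0 := by simp
        rw [ker_eq (by rw [him]; exact hk), him, hre, sub_zero]
        field_simp
      simp_rw [en]
      apply lintegral_tendsto_of_tendsto_of_monotone
      · intro k
        refine Measurable.aemeasurable ?_
        have := hrc.measurable
        fun_prop
      · refine Eventually.of_forall fun t => ?_
        intro k l hkl
        apply ENNReal.ofReal_le_ofReal
        have := hr0 t
        have hk : (0 : ℝ) < (k : ℝ) + 1 := by positivity
        have hkl' : (k : ℝ) + 1 ≤ (l : ℝ) + 1 := by
          have : (k : ℝ) ≤ l := by exact_mod_cast hkl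
          linarith
        simp only [div_pow]
        gcongr
      · refine Eventually.of_forall fun t => ?_
        apply ENNReal.tendsto_ofReal
        have a1 : Tendsto (fun k : ℕ => t / ((k : ℝ) + 1)) atTop (nhds 0) :=
          tendsto_const_nhds.div_atTop
            (tendsto_atTop_add_const_right _ _ tendsto_natCast_atTop_atTop)
        have a2 := (((a1.pow 2).const_add 1).inv₀ (by norm_num)).const_mul (r t)
        simpa using a2
    have m2 : Tendsto (fun k : ℕ => ∫⁻ t : ℝ, ENNReal.ofReal
        (((k : ℝ) + 1) ^ 2 * (r t * (‖(((k : ℝ) + 1 : ℝ) : ℂ) * I - (t : ℂ)‖ ^ 2)⁻¹)))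
        atTop (nhds 1) := by
      have a1 := (Complex.continuous_re.tendsto _).comp (hlim.comp
        (tendsto_atTop_add_const_right (f := fun k : ℕ => (k : ℝ)) atTop 1
          tendsto_natCast_atTop_atTop))
      have a2 := ENNReal.tendsto_ofReal a1
      simp only [Complex.one_re, ENNReal.ofReal_one] at a2
      refine a2.congr fun k => ?_
      have hk : (0 : ℝ) < (k : ℝ) + 1 := by positivity
      have him : ((((k : ℝ) + 1 : ℝ) : ℂ) * I).im = (k : ℝ) + 1 := by simp
      have hz : 0 < ((((k : ℝ) + 1 : ℝ) : ℂ) * I).im := by rw [him]; exact hk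
      rw [← ofReal_integral_eq_lintegral_ofReal ((hI _ hz).const_mul _)
        (Eventually.of_forall fun t => mul_nonneg (by positivity)
          (mul_nonneg (hr0 t) (by positivity))), integral_const_mul, hP _ hz, him]
      congr 1
      simp only [Function.comp_apply, Complex.mul_re, Complex.mul_im, Complex.ofReal_re,
        Complex.ofReal_im, Complex.I_re, Complex.I_im]
      field_simp
      ring
    exact tendsto_nhds_unique m1 m2
  let ρ : Measure ℝ := volume.withDensity d
  have hρ : IsProbabilityMeasure ρ := ⟨by
    simp only [ρ]
    rw [withDensity_apply _ MeasurableSet.univ, Measure.restrict_univ, hmass]⟩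
  refine ⟨ρ, hρ, ?_⟩
  have himeq : ∀ z : ℂ, 0 < z.im → (cauchyG ρ z).im = (g z).im := by
    intro z hz
    rw [cauchyG_im ρ hz]
    have e : ∫ t : ℝ, ‖(z - (t : ℂ))⁻¹‖ ^ 2 ∂ρ = ∫ t : ℝ, r t * (‖z - (t : ℂ)‖ ^ 2)⁻¹ := by
      simp only [ρ]
      rw [integral_withDensity_eq_integral_toReal_smul hdm
        (Eventually.of_forall fun t => ENNReal.ofReal_lt_top)]
      refine integral_congr_ae (Eventually.of_forall fun t => ?_)
      simp only [d]
      rw [ENNReal.toReal_ofReal (hr0 t), smul_eq_mul, norm_inv, inv_pow]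
    rw [e, hP z hz]
    have := hz.ne'
    field_simp
  have hdiff : DifferentiableOn ℂ (fun z => cauchyG ρ z - g z) upperHalf :=
    (cauchyG_differentiableOn ρ).sub (hd.mono fun w hw => by
      have : 0 < w.im := hw
      change -ε < w.im
      linarith)
  obtain ⟨c, hcc⟩ := (hdiff.analyticOnNhd isOpen_upperHalf).eq_const_of_im_eq_const (c₀ := 0)
    (fun z hz => by rw [Complex.sub_im, himeq z hz, sub_self]) isOpen_upperHalf
    isConnected_upperHalf
  have hc0 : ‖c‖ ≤ 0 := by
    have ht : Tendsto (fun y : ℝ => 2 * y⁻¹) atTop (nhds (2 * 0)) :=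
      tendsto_inv_atTop_zero.const_mul 2
    rw [mul_zero] at ht
    refine ge_of_tendsto ht ?_
    filter_upwards [eventually_gt_atTop 0] with y hy
    have him : ((y : ℂ) * I).im = y := by simp
    have hz : 0 < ((y : ℂ) * I).im := by rw [him]; exact hy
    rw [← hcc _ hz]
    refine (norm_sub_le _ _).trans ?_
    have h1 := norm_cauchyG_le ρ hz
    have h2 := hb _ hz
    rw [him] at h1 h2
    linarith
  have hc00 : c = 0 := norm_le_zero_iff.1 hc0
  intro z hz
  have := hcc z hz
  rw [hc00] at this
  exact sub_eq_zero.1 this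

lemma nev (G : ℂ → ℂ) (hd : DifferentiableOn ℂ G upperHalf)
    (hneg : ∀ w : ℂ, 0 < w.im → (G w).im ≤ 0)
    (hb : ∀ w : ℂ, 0 < w.im → ‖G w‖ ≤ w.im⁻¹)
    (hlim : Tendsto (fun y : ℝ => ((y : ℂ) * I) * G ((y : ℂ) * I)) atTop (nhds 1)) :
    ∃ ρ : Measure ℝ, IsProbabilityMeasure ρ ∧ ∀ z : ℂ, 0 < z.im → cauchyG ρ z = G z := by
  have key : ∀ (ε : ℝ), 0 < ε → ∃ ρ : Measure ℝ, IsProbabilityMeasure ρ ∧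
      ∀ z : ℂ, 0 < z.im → cauchyG ρ z = G (z + (ε : ℂ) * I) := by
    intro ε hε
    have him : ∀ w : ℂ, (w + (ε : ℂ) * I).im = w.im + ε := by intro w; simp
    refine nev_shift (fun z => G (z + (ε : ℂ) * I)) (ε := ε) (M := ε⁻¹) hε ?_ ?_ ?_ ?_ ?_
    · refine hd.comp (by fun_prop) ?_
      intro w hw
      have hw' : -ε < w.im := hw
      change 0 < (w + (ε : ℂ) * I).im
      rw [him]; linarith
    · intro w hw
      refine (hb _ (by rw [him]; linarith)).trans ?_
      rw [him]
      gcongr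
      linarith
    · intro w hw
      exact hneg _ (by rw [him]; linarith)
    · intro w hw
      refine (hb _ (by rw [him]; linarith)).trans ?_
      rw [him]
      gcongr
      linarith
    · have a1 := hlim.comp (tendsto_atTop_add_const_right atTop ε (tendsto_id (α := ℝ)))
      have a2 : Tendsto (fun y : ℝ => ((ε : ℂ) * I) * G (((y + ε : ℝ) : ℂ) * I)) atTop
          (nhds 0) := by
        apply squeeze_zero_norm' (a := fun y : ℝ => ε / y)
        · filter_upwards [eventually_gt_atTop 0] with y hy
          have h1 : (((y + ε : ℝ) : ℂ) * I).im = y + ε := by simp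
          have h2 := hb (((y + ε : ℝ) : ℂ) * I) (by rw [h1]; linarith)
          rw [h1] at h2
          rw [norm_mul, norm_mul, Complex.norm_I, Complex.norm_real, Real.norm_of_nonneg hε.le,
            mul_one, div_eq_mul_inv]
          gcongr
          refine h2.trans ?_
          gcongr
          linarith
        · exact tendsto_const_nhds.div_atTop tendsto_id
      have a3 := a1.sub a2
      rw [sub_zero] at a3
      refine a3.congr fun y => ?_
      simp only [Function.comp_apply, id]
      have : (((y + ε : ℝ) : ℂ) * I) = (y : ℂ) * I + (ε : ℂ) * I := by push_cast; ring
      rw [this]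
      ring
  have hpos : ∀ k : ℕ, (0:ℝ) < 1 / ((k : ℝ) + 1) := fun k => by positivity
  choose ρ hρ hρG using fun k : ℕ => key (1 / ((k : ℝ) + 1)) (hpos k)
  refine compact_lim ρ hρ G ?_ ?_
  · intro δ hδ
    have ev : ∀ᶠ y : ℝ in atTop, ‖1 - ((y : ℂ) * I) * G ((y : ℂ) * I)‖ < δ / 2 := by
      have := (hlim.const_sub 1).norm
      simp only [sub_self, norm_zero] at this
      exact this.eventually (gt_mem_nhds (half_pos hδ))
    obtain ⟨Y, hY⟩ := eventually_atTop.1 ev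
    refine ⟨max Y (max 1 (2 / δ)), by positivity, fun k => ?_⟩
    set y := max Y (max 1 (2 / δ)) with hy
    have hy0 : 0 < y := by positivity
    have hy2 : 2 / δ ≤ y := (le_max_right _ _).trans (le_max_right _ _)
    set ε := 1 / ((k : ℝ) + 1) with hε
    have hε0 : 0 < ε := hpos k
    have hε1 : ε ≤ 1 := by
      rw [hε, div_le_one (by positivity)]
      have : (0:ℝ) ≤ k := by positivity
      linarith
    rw [hρG k _ (by simpa using hy0)]
    have h1 := hY (y + ε) (by have := le_max_left Y (max 1 (2 / δ)); linarith)
    have h3 : (((y + ε : ℝ) : ℂ) * I).im = y + ε := by simp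
    have h2 := hb (((y + ε : ℝ) : ℂ) * I) (by rw [h3]; linarith)
    rw [h3] at h2
    have e0 : (((y + ε : ℝ) : ℂ) * I) = (y : ℂ) * I + (ε : ℂ) * I := by push_cast; ring
    rw [e0] at h1 h2
    have e : 1 - (y : ℂ) * I * G ((y : ℂ) * I + (ε : ℂ) * I) =
        (1 - ((y : ℂ) * I + (ε : ℂ) * I) * G ((y : ℂ) * I + (ε : ℂ) * I)) +
        ((ε : ℂ) * I) * G ((y : ℂ) * I + (ε : ℂ) * I) := by ring
    rw [e]
    refine (norm_add_le _ _).trans ?_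
    have h4 : ‖((ε : ℂ) * I) * G ((y : ℂ) * I + (ε : ℂ) * I)‖ ≤ δ / 2 := by
      rw [norm_mul, norm_mul, Complex.norm_I, Complex.norm_real, Real.norm_of_nonneg hε0.le,
        mul_one]
      calc _ ≤ 1 * (2 / δ)⁻¹ := by
            gcongr
            refine h2.trans ?_
            gcongr
            linarith
        _ = δ / 2 := by rw [one_mul, inv_div]
    linarith
  · intro z hz
    have hcont : ContinuousAt G z :=
      (hd.differentiableAt (isOpen_upperHalf.mem_nhds hz)).continuousAt
    have a1 : Tendsto (fun k : ℕ => z + ((1 / ((k : ℝ) + 1) : ℝ) : ℂ) * I) atTop (nhds z) := by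
      have b1 : Tendsto (fun k : ℕ => ((1 / ((k : ℝ) + 1) : ℝ) : ℂ)) atTop (nhds ((0:ℝ) : ℂ)) :=
        (Complex.continuous_ofReal.tendsto 0).comp tendsto_one_div_add_atTop_nhds_zero_nat
      have b2 := (b1.mul_const I).const_add z
      simpa using b2
    exact (hcont.tendsto.comp a1).congr fun k => (hρG k z hz).symm

/-- Fixed point iteration. -/
noncomputable def wseq (μ : Measure ℝ) (c : ℝ) : ℕ → ℂ → ℂ
  | 0 => fun z => z
  | k + 1 => fun z => z + (c : ℂ) * hF μ (wseq μ c k z)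

lemma wseq_im (μ : Measure ℝ) [IsProbabilityMeasure μ] {c : ℝ} (hc : 0 ≤ c) (k : ℕ) {z : ℂ}
    (hz : 0 < z.im) : z.im ≤ (wseq μ c k z).im := by
  induction k with
  | zero => simp [wseq]
  | succ k ih =>
    have := hF_im_nonneg μ (hz.trans_le ih)
    simp only [wseq, Complex.add_im, Complex.im_ofReal_mul]
    have := mul_nonneg hc this
    linarith

lemma wseq_diff (μ : Measure ℝ) [IsProbabilityMeasure μ] {c : ℝ} (hc : 0 ≤ c) (k : ℕ) :
    DifferentiableOn ℂ (wseq μ c k) upperHalf := by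
  induction k with
  | zero => exact differentiableOn_id
  | succ k ih =>
    refine differentiableOn_id.add (DifferentiableOn.const_mul ?_ _)
    exact (hF_differentiableOn μ).comp ih fun z (hz : 0 < z.im) =>
      hz.trans_le (wseq_im μ hc k hz)

lemma wseq_unif (μ : Measure ℝ) [IsProbabilityMeasure μ] {c : ℝ} (hc : 0 ≤ c) {δ : ℝ}
    (hδ : 0 < δ) : ∃ Y : ℝ, 0 < Y ∧ ∀ y ≥ Y, ∀ k,
      ‖wseq μ c k ((y : ℂ) * I) - (y : ℂ) * I‖ ≤ δ * y := by
  set η := min δ 2⁻¹ with hη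
  have hη0 : 0 < η := by positivity
  obtain ⟨Y, hY, h⟩ := cone μ (δ := η / (c + 1)) (by positivity)
  refine ⟨Y, hY, fun y hy k => ?_⟩
  have hy0 : 0 < y := hY.trans_le hy
  have main : ‖wseq μ c k ((y : ℂ) * I) - (y : ℂ) * I‖ ≤ η * y := by
    induction k with
    | zero => simp [wseq]; positivity
    | succ k ih =>
      have h2 : η * y ≤ y / 2 := by
        have : η ≤ 2⁻¹ := min_le_right _ _
        nlinarith
      have h3 := h y hy _ (ih.trans h2)
      simp only [wseq, add_sub_cancel_left, norm_mul, Complex.norm_real, Real.norm_of_nonneg hc]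
      calc c * ‖hF μ (wseq μ c k ((y : ℂ) * I))‖ ≤ (c + 1) * (η / (c + 1) * y) := by
            gcongr; linarith
        _ = η * y := by field_simp
  refine main.trans ?_
  gcongr
  exact min_le_left _ _

lemma one_sub_div_le {w : ℂ} {y δ : ℝ} (hy : 0 < y) (hw : y ≤ w.im)
    (h : ‖w - (y : ℂ) * I‖ ≤ δ * y) : ‖1 - ((y : ℂ) * I) * w⁻¹‖ ≤ δ := by
  have hn : y ≤ ‖w‖ := hw.trans ((le_abs_self _).trans (Complex.abs_im_le_norm w))
  have hpos : 0 < ‖w‖ := hy.trans_le hn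
  have hne : w ≠ 0 := norm_pos_iff.1 hpos
  have hδ : 0 ≤ δ := by
    have := (norm_nonneg _).trans h
    nlinarith
  have e : 1 - ((y : ℂ) * I) * w⁻¹ = (w - (y : ℂ) * I) / w := by field_simp
  rw [e, norm_div, div_le_iff₀ hpos]
  exact h.trans (by gcongr)

lemma wseq_measure (μ : Measure ℝ) [IsProbabilityMeasure μ] {c : ℝ} (hc : 0 ≤ c) (k : ℕ) :
    ∃ ρ : Measure ℝ, IsProbabilityMeasure ρ ∧
      ∀ z : ℂ, 0 < z.im → cauchyG ρ z = (wseq μ c k z)⁻¹ := by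
  have him : ∀ z : ℂ, 0 < z.im → z.im ≤ (wseq μ c k z).im := fun z hz => wseq_im μ hc k hz
  refine nev (fun z => (wseq μ c k z)⁻¹) ?_ ?_ ?_ ?_
  · refine (wseq_diff μ hc k).inv fun z (hz : 0 < z.im) h => ?_
    have := him z hz
    rw [h] at this
    simp at this
    linarith
  · intro z hz
    have := him z hz
    rw [Complex.inv_im]
    exact div_nonpos_of_nonpos_of_nonneg (by linarith) (Complex.normSq_nonneg _)
  · intro z hz
    have := him z hz
    rw [norm_inv]
    exact inv_anti₀ hz (this.trans ((le_abs_self _).trans (Complex.abs_im_le_norm _)))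
  · rw [Metric.tendsto_atTop]
    intro ε hε
    obtain ⟨Y, hY, h⟩ := wseq_unif μ hc (half_pos hε)
    refine ⟨Y, fun y hy => ?_⟩
    have hy0 : 0 < y := hY.trans_le hy
    rw [dist_comm, dist_eq_norm]
    have := one_sub_div_le hy0 (by simpa using him ((y : ℂ) * I) (by simpa using hy0)) (h y hy k)
    linarith

lemma wseq_bdd (μ : Measure ℝ) [IsProbabilityMeasure μ] {c : ℝ} (hc : 0 ≤ c) {z : ℂ}
    (hz : 0 < z.im) : ∃ B : ℝ, 0 < B ∧ ∀ k, ‖wseq μ c k z‖ ≤ B := by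
  obtain ⟨Y, hY, h⟩ := wseq_unif μ hc (δ := 2⁻¹) (by norm_num)
  set C : ℝ := 2 * ‖z‖ ^ 2 / Y ^ 2 + 2 with hC
  have hC0 : 0 < C := by positivity
  set b : ℝ := z.im * (C⁻¹ * ((3 * Y / 2) ^ 2)⁻¹) with hb
  have hb0 : 0 < b := by positivity
  refine ⟨b⁻¹, by positivity, fun k => ?_⟩
  obtain ⟨ρ, hρ, hG⟩ := wseq_measure μ hc k
  have him : ((Y : ℂ) * I).im = Y := by simp
  have hre : ((Y : ℂ) * I).re = 0 := by simp
  have hz0 : 0 < ((Y : ℂ) * I).im := by rw [him]; exact hY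
  have h1 : ((3 * Y / 2) ^ 2)⁻¹ ≤ ∫ t : ℝ, ‖((Y : ℂ) * I - (t : ℂ))⁻¹‖ ^ 2 ∂ρ := by
    have e1 := cauchyG_im ρ hz0
    rw [hG _ hz0, him, Complex.inv_im] at e1
    have i1 := wseq_im μ hc k hz0
    rw [him] at i1
    have n1 := h Y le_rfl k
    set w := wseq μ c k ((Y : ℂ) * I) with hw
    have hwn : ‖w‖ ≤ 3 * Y / 2 := by
      have : ‖w‖ ≤ ‖w - (Y : ℂ) * I‖ + ‖(Y : ℂ) * I‖ := norm_le_norm_sub_add _ _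
      simp [abs_of_pos hY] at this
      linarith
    have hwpos : 0 < ‖w‖ :=
      (hY.trans_le i1).trans_le ((le_abs_self _).trans (Complex.abs_im_le_norm w))
    rw [Complex.normSq_eq_norm_sq] at e1
    have e2 : ∫ t : ℝ, ‖((Y : ℂ) * I - (t : ℂ))⁻¹‖ ^ 2 ∂ρ = w.im / ‖w‖ ^ 2 / Y := by
      rw [eq_div_iff hY.ne']
      rw [neg_div] at e1
      linarith
    rw [e2]
    calc ((3 * Y / 2) ^ 2)⁻¹ ≤ (‖w‖ ^ 2)⁻¹ := by gcongr
      _ = Y / ‖w‖ ^ 2 / Y := by field_simp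
      _ ≤ _ := by gcongr
  have h2 : C⁻¹ * ∫ t : ℝ, ‖((Y : ℂ) * I - (t : ℂ))⁻¹‖ ^ 2 ∂ρ ≤
      ∫ t : ℝ, ‖(z - (t : ℂ))⁻¹‖ ^ 2 ∂ρ := by
    rw [← integral_const_mul]
    refine integral_mono ((integrable_sq ρ hz0).const_mul _) (integrable_sq ρ hz) fun t => ?_
    simp only [norm_inv, inv_pow]
    rw [← mul_inv]
    have hpos : 0 < ‖z - (t : ℂ)‖ := norm_pos_iff.2 (sub_ofReal_ne hz t)
    refine inv_anti₀ (by positivity) ?_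
    rw [normSub_sq_eq ((Y : ℂ) * I), him, hre, sub_zero]
    have t1 : ‖z - (t : ℂ)‖ ≤ ‖z‖ + |t| := by
      simpa using norm_sub_le z (t : ℂ)
    have t2 : ‖z - (t : ℂ)‖ ^ 2 ≤ 2 * ‖z‖ ^ 2 + 2 * t ^ 2 := by
      rw [← sq_abs t]
      nlinarith [sq_nonneg (‖z‖ - |t|), norm_nonneg z, abs_nonneg t]
    have t3 : C * (t ^ 2 + Y ^ 2) = 2 * ‖z‖ ^ 2 / Y ^ 2 * t ^ 2 + 2 * ‖z‖ ^ 2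
        + 2 * t ^ 2 + 2 * Y ^ 2 := by
      rw [hC]; field_simp
      ring
    have t4 : 0 ≤ 2 * ‖z‖ ^ 2 / Y ^ 2 * t ^ 2 := by positivity
    have t5 : 0 ≤ Y ^ 2 := by positivity
    linarith
  have h3 : b ≤ ‖(wseq μ c k z)⁻¹‖ := by
    rw [← hG z hz]
    refine le_trans ?_ ((neg_le_abs _).trans (Complex.abs_im_le_norm _))
    rw [cauchyG_im ρ hz, hb, neg_mul, neg_neg]
    gcongr
    exact le_trans (by gcongr) h2
  rw [norm_inv] at h3
  exact (le_inv_comm₀ hb0 (inv_pos.1 (hb0.trans_le h3))).1 h3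

lemma wseq_cauchy (μ : Measure ℝ) [IsProbabilityMeasure μ] {c : ℝ} (hc : 0 ≤ c) {z : ℂ}
    (hz : 0 < z.im) : CauchySeq (fun k => wseq μ c k z) := by
  obtain ⟨B, hB, hk⟩ := wseq_bdd μ hc hz
  set u : ℕ → ℂ := fun k => wseq μ c k z with hu
  have hv : ∀ k, z.im ≤ (u k).im := fun k => wseq_im μ hc k hz
  have hv0 : ∀ k, 0 < (u k).im := fun k => hz.trans_le (hv k)
  have hvB : ∀ k, (u k).im ≤ B := fun k =>
    (le_abs_self _).trans ((Complex.abs_im_le_norm _).trans (hk k))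
  have hrec : ∀ k, u (k + 1) = z + (c : ℂ) * hF μ (u k) := fun k => rfl
  have hcim : ∀ k, c * (hF μ (u k)).im = (u (k + 1)).im - z.im := by
    intro k
    rw [hrec]; simp
  set s : ℝ := 1 - z.im / B with hs
  have hs0 : 0 ≤ s := by
    have : z.im / B ≤ 1 := (div_le_one hB).2 ((hv 0).trans (hvB 0))
    linarith
  have hs1 : s < 1 := by
    have : 0 < z.im / B := by positivity
    linarith
  have hsub : ∀ k, (u k).im - z.im ≤ (u k).im * s := by
    intro k
    have : (u k).im * (z.im / B) ≤ z.im := by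
      rw [mul_div_assoc', div_le_iff₀ hB]
      nlinarith [hvB k]
    rw [hs]; linarith
  set D : ℝ := ‖u 1 - u 0‖ ^ 2 / ((u 1).im * (u 0).im) with hD
  have hD0 : 0 ≤ D := by
    have := hv0 1
    have := hv0 0
    positivity
  have main : ∀ k, ‖u (k + 1) - u k‖ ^ 2 ≤ D * (s ^ 2) ^ k * ((u (k + 1)).im * (u k).im) := by
    intro k
    induction k with
    | zero =>
      have := hv0 1
      have := hv0 0
      rw [hD, zero_add, pow_zero, mul_one, div_mul_cancel₀ _ (by positivity)]
    | succ k ih =>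
      have p := pick μ (hv0 (k + 1)) (hv0 k)
      have e : u (k + 1 + 1) - u (k + 1) = (c : ℂ) * (hF μ (u (k + 1)) - hF μ (u k)) := by
        rw [hrec (k + 1)]
        nth_rw 2 [hrec k]
        ring
      have q1 := hv0 (k + 1)
      have q0 := hv0 k
      have q2 := hv0 (k + 1 + 1)
      have d1 : 0 ≤ (u (k + 1)).im - z.im := by linarith [hv (k + 1)]
      have d2 : 0 ≤ (u (k + 1 + 1)).im - z.im := by linarith [hv (k + 1 + 1)]
      have hpos : 0 < (u (k + 1)).im * (u k).im := by positivity
      refine le_of_mul_le_mul_right ?_ hpos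
      calc ‖u (k + 1 + 1) - u (k + 1)‖ ^ 2 * ((u (k + 1)).im * (u k).im)
          = c ^ 2 * (‖hF μ (u (k + 1)) - hF μ (u k)‖ ^ 2 * ((u (k + 1)).im * (u k).im)) := by
            rw [e, norm_mul, Complex.norm_real, Real.norm_of_nonneg hc]; ring
        _ ≤ c ^ 2 * (‖u (k + 1) - u k‖ ^ 2 * ((hF μ (u (k + 1))).im * (hF μ (u k)).im)) := by
            gcongr
        _ = ‖u (k + 1) - u k‖ ^ 2 * ((c * (hF μ (u (k + 1))).im) * (c * (hF μ (u k)).im)) := by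
            ring
        _ = ‖u (k + 1) - u k‖ ^ 2 *
              (((u (k + 1 + 1)).im - z.im) * ((u (k + 1)).im - z.im)) := by
            rw [hcim, hcim]
        _ ≤ (D * (s ^ 2) ^ k * ((u (k + 1)).im * (u k).im)) *
              (((u (k + 1 + 1)).im * s) * ((u (k + 1)).im * s)) := by
            gcongr
            · exact hsub _
            · exact hsub _
        _ = _ := by ring
  refine cauchySeq_of_le_geometric s (√D * B) hs1 fun k => ?_
  rw [dist_comm, dist_eq_norm]
  refine (pow_le_pow_iff_left₀ (norm_nonneg _) (by positivity) two_ne_zero).1 ?_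
  calc ‖u (k + 1) - u k‖ ^ 2 ≤ D * (s ^ 2) ^ k * ((u (k + 1)).im * (u k).im) := main k
    _ ≤ D * (s ^ 2) ^ k * (B * B) := by
      have := hv0 (k + 1)
      have := hv0 k
      gcongr
      · exact hvB _
      · exact hvB _
    _ = (√D * B * s ^ k) ^ 2 := by
      rw [mul_pow, mul_pow, Real.sq_sqrt hD0]; ring

lemma fixed_unique (μ : Measure ℝ) [IsProbabilityMeasure μ] {c : ℝ} (hc : 0 ≤ c) {z a b : ℂ}
    (hz : 0 < z.im) (ha : 0 < a.im) (hb : 0 < b.im) (ea : a = z + (c : ℂ) * hF μ a)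
    (eb : b = z + (c : ℂ) * hF μ b) : a = b := by
  have p := pick μ ha hb
  have ia : c * (hF μ a).im = a.im - z.im := by
    have := congrArg Complex.im ea
    simp at this
    linarith
  have ib : c * (hF μ b).im = b.im - z.im := by
    have := congrArg Complex.im eb
    simp at this
    linarith
  have e : a - b = (c : ℂ) * (hF μ a - hF μ b) := by linear_combination ea - eb
  have en : ‖a - b‖ ^ 2 = c ^ 2 * ‖hF μ a - hF μ b‖ ^ 2 := by
    rw [e, norm_mul, Complex.norm_real, Real.norm_of_nonneg hc, mul_pow]
  have h1 : ‖a - b‖ ^ 2 * (a.im * b.im) ≤ ‖a - b‖ ^ 2 * ((a.im - z.im) * (b.im - z.im)) := by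
    calc ‖a - b‖ ^ 2 * (a.im * b.im) = c ^ 2 * (‖hF μ a - hF μ b‖ ^ 2 * (a.im * b.im)) := by
          rw [en]; ring
      _ ≤ c ^ 2 * (‖a - b‖ ^ 2 * ((hF μ a).im * (hF μ b).im)) := by gcongr
      _ = ‖a - b‖ ^ 2 * ((c * (hF μ a).im) * (c * (hF μ b).im)) := by ring
      _ = _ := by rw [ia, ib]
  have ja : z.im ≤ a.im := by
    have := mul_nonneg hc (hF_im_nonneg μ ha)
    linarith
  have h2 : (a.im - z.im) * (b.im - z.im) < a.im * b.im := by
    nlinarith [mul_pos hz hb]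
  by_contra hne
  have hp : 0 < ‖a - b‖ ^ 2 := by
    have : 0 < ‖a - b‖ := norm_pos_iff.2 (sub_ne_zero.2 hne)
    positivity
  have := mul_lt_mul_of_pos_left h2 hp
  linarith

/-- Corollary 2.3: subordination function for the n-fold additive free convolution power. -/
theorem additive_subordination_power (μ : Measure ℝ) (hμ : IsProbabilityMeasure μ)
    (n : ℕ) (hn : 2 ≤ n) :
    ∃ Z : ℂ → ℂ, classF Z ∧
      (∀ z ∈ upperHalf, z = (n : ℂ) * Z z - ((n : ℂ) - 1) * recF μ (Z z)) ∧
      (∀ W : ℂ → ℂ, classF W →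
        (∀ z ∈ upperHalf, z = (n : ℂ) * W z - ((n : ℂ) - 1) * recF μ (W z)) →
        ∀ z ∈ upperHalf, W z = Z z) := by
  have hc : (0:ℝ) ≤ (n : ℝ) - 1 := by
    have : (2:ℝ) ≤ n := by exact_mod_cast hn
    linarith
  set c : ℝ := (n : ℝ) - 1 with hcdef
  have hcc : (c : ℂ) = (n : ℂ) - 1 := by rw [hcdef]; push_cast; rfl
  have heq : ∀ z w : ℂ, z = (n : ℂ) * w - ((n : ℂ) - 1) * recF μ w ↔
      w = z + (c : ℂ) * hF μ w := by
    intro z w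
    rw [hcc, hF]
    constructor
    · intro h; linear_combination -h
    · intro h; linear_combination -h
  choose! Z hZ using fun (z : ℂ) (hz : 0 < z.im) =>
    cauchySeq_tendsto_of_complete (wseq_cauchy μ hc hz)
  have hZim : ∀ z : ℂ, 0 < z.im → z.im ≤ (Z z).im := fun z hz =>
    ge_of_tendsto ((Complex.continuous_im.tendsto _).comp (hZ z hz))
      (Eventually.of_forall fun k => wseq_im μ hc k hz)
  have hZfix : ∀ z : ℂ, 0 < z.im → Z z = z + (c : ℂ) * hF μ (Z z) := by
    intro z hz
    have hcont : ContinuousAt (hF μ) (Z z) :=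
      ((hF_differentiableOn μ).differentiableAt
        (isOpen_upperHalf.mem_nhds (hz.trans_le (hZim z hz)))).continuousAt
    have a1 : Tendsto (fun k => wseq μ c (k + 1) z) atTop (nhds (z + (c : ℂ) * hF μ (Z z))) :=
      ((hcont.tendsto.comp (hZ z hz)).const_mul (c : ℂ)).const_add z
    exact tendsto_nhds_unique ((tendsto_add_atTop_iff_nat 1).2 (hZ z hz)) a1
  refine ⟨Z, ?_, fun z hz => (heq z (Z z)).2 (hZfix z hz), ?_⟩
  · choose ν hν hνG using fun k => wseq_measure μ hc k
    obtain ⟨ρ, hρ, hρG⟩ := compact_lim ν hν (fun z => (Z z)⁻¹) (by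
      intro δ hδ
      obtain ⟨Y, hY, h⟩ := wseq_unif μ hc hδ
      refine ⟨Y, hY, fun k => ?_⟩
      have hz : 0 < ((Y : ℂ) * I).im := by simpa using hY
      rw [hνG k _ hz]
      exact one_sub_div_le hY (by simpa using wseq_im μ hc k hz) (h Y le_rfl k)) (by
      intro z hz
      have hne : Z z ≠ 0 := by
        intro h
        have := hZim z hz
        rw [h] at this
        simp at this
        linarith
      exact ((hZ z hz).inv₀ hne).congr fun k => (hνG k z hz).symm)
    refine ⟨ρ, hρ, fun z hz => ?_⟩
    rw [recF, hρG z hz, inv_inv]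
  · rintro W ⟨ρ, hρ, hW⟩ hWeq z hz
    have hWim : 0 < (W z).im := by
      have hz' : 0 < z.im := hz
      have := hF_im_nonneg ρ hz'
      rw [hF, Complex.sub_im] at this
      rw [hW z hz]
      linarith
    have hz' : 0 < z.im := hz
    exact fixed_unique μ hc hz' hWim (hz'.trans_le (hZim z hz')) ((heq z (W z)).1 (hWeq z hz))
      (hZfix z hz')
end

section
/- Let μ₁ and μ₂ be measures in ℳ_*. Then there exist unique functions Z₁ and Z₂ in the class 𝒮_* such that for all z ∈ 𝔻 one has Z₁(z)·Z₂(z) = z·Q_{μ₁}(Z₁(z)) and Q_{μ₁}(Z₁(z)) = Q_{μ₂}(Z₂(z)). -/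
open MeasureTheory Complex Filter Set

/-- Open unit disk. -/
def unitDisk : Set ℂ := Metric.ball 0 1

/-- The class ℳ_* of Borel probability measures on the unit circle 𝕋
with nonzero first moment. -/
def MStar (μ : Measure ℂ) : Prop :=
  IsProbabilityMeasure μ ∧ μ ((Metric.sphere (0 : ℂ) 1)ᶜ) = 0 ∧ (∫ ξ, ξ ∂μ) ≠ 0

/-- ψ_μ(z) = ∫ zξ/(1 − zξ) dμ(ξ). -/
noncomputable def psiStar (μ : Measure ℂ) (z : ℂ) : ℂ :=
  ∫ ξ, (z * ξ) / (1 - z * ξ) ∂μ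

/-- Q_μ = ψ_μ/(1 + ψ_μ). -/
noncomputable def QStar (μ : Measure ℂ) (z : ℂ) : ℂ :=
  psiStar μ z / (1 + psiStar μ z)

/-- The class 𝒮_*: Schur functions Q with Q(0) = 0 and Q′(0) ≠ 0. -/
def schurStar (Q : ℂ → ℂ) : Prop :=
  DifferentiableOn ℂ Q unitDisk ∧ (∀ z ∈ unitDisk, ‖Q z‖ ≤ 1) ∧
  Q 0 = 0 ∧ deriv Q 0 ≠ 0

open Topology

lemma mem_uD {z : ℂ} : z ∈ unitDisk ↔ ‖z‖ < 1 := by simp [unitDisk]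

lemma isOpen_uD : IsOpen unitDisk := Metric.isOpen_ball

lemma local_lip {F : ℂ → ℂ} (hF : DifferentiableOn ℂ F unitDisk) :
    ∃ L δ : ℝ, 0 ≤ L ∧ 0 < δ ∧ ∀ a b : ℂ, ‖a‖ < δ → ‖b‖ < δ → ‖F a - F b‖ ≤ L * ‖a - b‖ := by
  have hmem : unitDisk ∈ 𝓝 (0 : ℂ) := isOpen_uD.mem_nhds (by simp [mem_uD])
  have hc : ContDiffAt ℂ 1 F 0 := (hF.analyticAt hmem).contDiffAt
  obtain ⟨K, t, ht, hK⟩ := hc.exists_lipschitzOnWith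
  obtain ⟨δ, hδ, hsub⟩ := Metric.mem_nhds_iff.1 ht
  refine ⟨K, δ, K.2, hδ, fun a b ha hb => ?_⟩
  have := hK.dist_le_mul a (hsub (by simpa using ha)) b (hsub (by simpa using hb))
  simpa [dist_eq_norm] using this

/-- contraction estimate near 0 -/
lemma local_contr {F₁ F₂ : ℂ → ℂ} (hF₁ : DifferentiableOn ℂ F₁ unitDisk)
    (hF₂ : DifferentiableOn ℂ F₂ unitDisk) (hb₁ : ∀ z ∈ unitDisk, ‖F₁ z‖ ≤ 1) :
    ∃ L δ : ℝ, 0 ≤ L ∧ 0 < δ ∧ δ ≤ 1 ∧ ∀ z a b : ℂ, ‖z‖ < δ → ‖a‖ ≤ ‖z‖ → ‖b‖ ≤ ‖z‖ →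
      ‖z * F₂ (z * F₁ a) - z * F₂ (z * F₁ b)‖ ≤ L * ‖z‖ * ‖a - b‖ := by
  obtain ⟨L₁, δ₁, hL₁, hδ₁, h₁⟩ := local_lip hF₁
  obtain ⟨L₂, δ₂, hL₂, hδ₂, h₂⟩ := local_lip hF₂
  refine ⟨L₂ * L₁, min (min δ₁ δ₂) 1, by positivity, by positivity, min_le_right _ _, ?_⟩
  intro z a b hz ha hb
  simp only [lt_min_iff] at hz
  obtain ⟨⟨hz1, hz2⟩, hz3⟩ := hz
  have key : ∀ c : ℂ, ‖c‖ ≤ ‖z‖ → ‖z * F₁ c‖ < δ₂ := by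
    intro c hc
    rw [norm_mul]
    have := hb₁ c (mem_uD.2 (by linarith))
    nlinarith [norm_nonneg z]
  have e1 := h₁ a b (by linarith) (by linarith)
  have e2 := h₂ _ _ (key a ha) (key b hb)
  rw [← mul_sub, norm_mul] at e2 ⊢
  have hn := norm_nonneg z
  calc ‖z‖ * ‖F₂ (z * F₁ a) - F₂ (z * F₁ b)‖
      ≤ ‖z‖ * (L₂ * (‖z‖ * ‖F₁ a - F₁ b‖)) := by gcongr
    _ ≤ ‖z‖ * (L₂ * (1 * (L₁ * ‖a - b‖))) := by gcongr
    _ = _ := by ring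

def iterG (F₁ F₂ : ℂ → ℂ) : ℕ → ℂ → ℂ
  | 0, _ => 0
  | n + 1, z => z * F₂ (z * F₁ (iterG F₁ F₂ n z))

lemma mul_mem_uD {F : ℂ → ℂ} (hb : ∀ z ∈ unitDisk, ‖F z‖ ≤ 1) {z w : ℂ}
    (hw : w ∈ unitDisk) : ‖z * F w‖ ≤ ‖z‖ := by
  rw [norm_mul]; exact mul_le_of_le_one_right (norm_nonneg _) (hb _ hw)

lemma iterG_norm {F₁ F₂ : ℂ → ℂ}
    (hb₁ : ∀ z ∈ unitDisk, ‖F₁ z‖ ≤ 1)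
    (hb₂ : ∀ z ∈ unitDisk, ‖F₂ z‖ ≤ 1) (n : ℕ) {z : ℂ} (hz : z ∈ unitDisk) : ‖iterG F₁ F₂ n z‖ ≤ ‖z‖ := by
  induction n with
  | zero => simp [iterG]
  | succ n ih =>
    have h1 : iterG F₁ F₂ n z ∈ unitDisk := mem_uD.2 (ih.trans_lt (mem_uD.1 hz))
    exact mul_mem_uD hb₂ (mem_uD.2 ((mul_mem_uD hb₁ h1).trans_lt (mem_uD.1 hz)))

lemma comp_diff {F₁ F₂ : ℂ → ℂ}
    (hF₁ : DifferentiableOn ℂ F₁ unitDisk)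
    (hF₂ : DifferentiableOn ℂ F₂ unitDisk)
    (hb₁ : ∀ z ∈ unitDisk, ‖F₁ z‖ ≤ 1) {W : ℂ → ℂ} (hW : DifferentiableOn ℂ W unitDisk)
    (hWn : ∀ z ∈ unitDisk, ‖W z‖ ≤ ‖z‖) :
    DifferentiableOn ℂ (fun z => z * F₁ (W z)) unitDisk ∧
    DifferentiableOn ℂ (fun z => F₂ (z * F₁ (W z))) unitDisk := by
  have hm : MapsTo W unitDisk unitDisk := fun z hz =>
    mem_uD.2 ((hWn z hz).trans_lt (mem_uD.1 hz))
  have h1 : DifferentiableOn ℂ (fun z => z * F₁ (W z)) unitDisk :=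
    differentiableOn_id.mul (hF₁.comp hW hm)
  refine ⟨h1, hF₂.comp h1 fun z hz => ?_⟩
  exact mem_uD.2 ((mul_mem_uD hb₁ (hm hz)).trans_lt (mem_uD.1 hz))

lemma iterG_diff {F₁ F₂ : ℂ → ℂ}
    (hF₁ : DifferentiableOn ℂ F₁ unitDisk)
    (hF₂ : DifferentiableOn ℂ F₂ unitDisk)
    (hb₁ : ∀ z ∈ unitDisk, ‖F₁ z‖ ≤ 1)
    (hb₂ : ∀ z ∈ unitDisk, ‖F₂ z‖ ≤ 1) (n : ℕ) : DifferentiableOn ℂ (iterG F₁ F₂ n) unitDisk := by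
  induction n with
  | zero => exact differentiableOn_const 0
  | succ n ih =>
    exact differentiableOn_id.mul
      (comp_diff hF₁ hF₂ hb₁ ih (fun z hz => iterG_norm hb₁ hb₂ n hz)).2

lemma iterG_bound {F₁ F₂ : ℂ → ℂ}
    (hF₁ : DifferentiableOn ℂ F₁ unitDisk)
    (hF₂ : DifferentiableOn ℂ F₂ unitDisk)
    (hb₁ : ∀ z ∈ unitDisk, ‖F₁ z‖ ≤ 1)
    (hb₂ : ∀ z ∈ unitDisk, ‖F₂ z‖ ≤ 1) (n : ℕ) {z : ℂ} (hz : z ∈ unitDisk) :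
    ‖iterG F₁ F₂ (n + 1) z - iterG F₁ F₂ n z‖ ≤ 2 * ‖z‖ ^ (n + 1) := by
  obtain ⟨L, δ, hL, hδ, hδ1, hc⟩ := local_contr hF₁ hF₂ hb₁
  have hO : ∀ n : ℕ, ∀ z : ℂ, ‖z‖ < δ →
      ‖iterG F₁ F₂ (n + 1) z - iterG F₁ F₂ n z‖ ≤ L ^ n * ‖z‖ ^ (n + 1) := by
    intro n
    induction n with
    | zero =>
      intro z hz
      have hz' : z ∈ unitDisk := mem_uD.2 (by linarith)
      simpa [iterG] using iterG_norm hb₁ hb₂ 1 hz'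
    | succ n ih =>
      intro z hz
      have hz' : z ∈ unitDisk := mem_uD.2 (by linarith)
      have := hc z _ _ hz (iterG_norm hb₁ hb₂ (n + 1) hz') (iterG_norm hb₁ hb₂ n hz')
      calc _ ≤ L * ‖z‖ * ‖iterG F₁ F₂ (n + 1) z - iterG F₁ F₂ n z‖ := this
        _ ≤ L * ‖z‖ * (L ^ n * ‖z‖ ^ (n + 1)) := by gcongr; exact ih z hz
        _ = _ := by ring
  have h00 : ∀ m, iterG F₁ F₂ m 0 = 0 := fun m => by cases m <;> simp [iterG]
  have hD : DifferentiableOn ℂ (fun z => iterG F₁ F₂ (n + 1) z - iterG F₁ F₂ n z)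
      (Metric.ball 0 1) := (iterG_diff hF₁ hF₂ hb₁ hb₂ (n + 1)).sub (iterG_diff hF₁ hF₂ hb₁ hb₂ n)
  have := Complex.dist_le_mul_div_pow_of_mapsTo_ball_of_isLittleO (R₂ := 2) (n := n) hD
    (fun w hw => ?_) ?_ hz
  · simpa [h00, dist_eq_norm] using this
  · have hw' : w ∈ unitDisk := hw
    have a1 := iterG_norm hb₁ hb₂ (n + 1) hw'
    have a2 := iterG_norm hb₁ hb₂ n hw'
    have a3 := mem_uD.1 hw'
    simp only [h00, sub_zero, mem_closedBall_zero_iff]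
    exact (norm_sub_le _ _).trans (by linarith)
  · simp only [h00, sub_zero]
    have h1 : (fun z => iterG F₁ F₂ (n + 1) z - iterG F₁ F₂ n z) =O[𝓝 0]
        (fun z : ℂ => ‖z‖ ^ (n + 1)) := by
      refine Asymptotics.IsBigO.of_bound (L ^ n) ?_
      filter_upwards [Metric.ball_mem_nhds (0 : ℂ) hδ] with w hw
      simpa using hO n w (by simpa using hw)
    refine h1.trans_isLittleO ?_
    have h2 := (Asymptotics.isLittleO_pow_pow (𝕜 := ℝ) (Nat.lt_succ_self n))
    exact h2.comp_tendsto (k := fun z : ℂ => ‖z‖) (by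
      simpa using (continuous_norm (E := ℂ)).tendsto 0)

lemma exists_fix {F₁ F₂ : ℂ → ℂ}
    (hF₁ : DifferentiableOn ℂ F₁ unitDisk)
    (hF₂ : DifferentiableOn ℂ F₂ unitDisk)
    (hb₁ : ∀ z ∈ unitDisk, ‖F₁ z‖ ≤ 1)
    (hb₂ : ∀ z ∈ unitDisk, ‖F₂ z‖ ≤ 1) : ∃ Z : ℂ → ℂ, DifferentiableOn ℂ Z unitDisk ∧
    (∀ z ∈ unitDisk, ‖Z z‖ ≤ ‖z‖) ∧ ∀ z ∈ unitDisk, Z z = z * F₂ (z * F₁ (Z z)) := by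
  set D : ℕ → ℂ → ℂ := fun n z => iterG F₁ F₂ (n + 1) z - iterG F₁ F₂ n z with hDdef
  have hdiff : DifferentiableOn ℂ (fun z => ∑' n, D n z) unitDisk := by
    intro z hz
    obtain ⟨r, hr1, hr2⟩ := exists_between (mem_uD.1 hz)
    have hr0 : 0 ≤ r := (norm_nonneg z).trans hr1.le
    have hsub : Metric.ball (0 : ℂ) r ⊆ unitDisk := Metric.ball_subset_ball hr2.le
    have hs : Summable (fun n : ℕ => 2 * r ^ (n + 1)) :=
      ((summable_nat_add_iff 1).2 (summable_geometric_of_lt_one hr0 hr2)).mul_left 2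
    have := Complex.differentiableOn_tsum_of_summable_norm (F := D) (U := Metric.ball 0 r) hs
      (fun n => ((iterG_diff hF₁ hF₂ hb₁ hb₂ (n + 1)).sub
        (iterG_diff hF₁ hF₂ hb₁ hb₂ n)).mono hsub) Metric.isOpen_ball
      (fun n w hw => (iterG_bound hF₁ hF₂ hb₁ hb₂ n (hsub hw)).trans (by
        have : ‖w‖ < r := by simpa using hw
        gcongr))
    exact ((this z (by simpa using hr1)).differentiableAt
      (Metric.isOpen_ball.mem_nhds (by simpa using hr1))).differentiableWithinAt
  have hlim : ∀ z ∈ unitDisk, Tendsto (fun n => iterG F₁ F₂ n z) atTop (𝓝 (∑' n, D n z)) := by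
    intro z hz
    have hs : Summable (fun n : ℕ => 2 * ‖z‖ ^ (n + 1)) :=
      ((summable_nat_add_iff 1).2
        (summable_geometric_of_lt_one (norm_nonneg z) (mem_uD.1 hz))).mul_left 2
    have hs' : Summable (fun n => D n z) :=
      Summable.of_norm_bounded hs (fun n => iterG_bound hF₁ hF₂ hb₁ hb₂ n hz)
    have := hs'.hasSum.tendsto_sum_nat
    refine this.congr fun n => ?_
    rw [hDdef, Finset.sum_range_sub (fun n => iterG F₁ F₂ n z)]
    simp [iterG]
  have hnorm : ∀ z ∈ unitDisk, ‖∑' n, D n z‖ ≤ ‖z‖ := fun z hz =>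
    le_of_tendsto (hlim z hz).norm (Eventually.of_forall fun n => iterG_norm hb₁ hb₂ n hz)
  refine ⟨fun z => ∑' n, D n z, hdiff, hnorm, fun z hz => ?_⟩
  have hZ : (∑' n, D n z) ∈ unitDisk := mem_uD.2 ((hnorm z hz).trans_lt (mem_uD.1 hz))
  have hZ' : z * F₁ (∑' n, D n z) ∈ unitDisk :=
    mem_uD.2 ((mul_mem_uD hb₁ hZ).trans_lt (mem_uD.1 hz))
  have c1 := hF₁.continuousOn.continuousAt (isOpen_uD.mem_nhds hZ)
  have c2 := hF₂.continuousOn.continuousAt (isOpen_uD.mem_nhds hZ')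
  have t1 := (c2.tendsto.comp ((c1.tendsto.comp (hlim z hz)).const_mul z)).const_mul z
  exact tendsto_nhds_unique ((tendsto_add_atTop_iff_nat 1).2 (hlim z hz)) t1

lemma fix_unique {F₁ F₂ : ℂ → ℂ}
    (hF₁ : DifferentiableOn ℂ F₁ unitDisk)
    (hF₂ : DifferentiableOn ℂ F₂ unitDisk)
    (hb₁ : ∀ z ∈ unitDisk, ‖F₁ z‖ ≤ 1) {Z W : ℂ → ℂ} (hZ : DifferentiableOn ℂ Z unitDisk)
    (hW : DifferentiableOn ℂ W unitDisk)
    (hZn : ∀ z ∈ unitDisk, ‖Z z‖ ≤ ‖z‖) (hWn : ∀ z ∈ unitDisk, ‖W z‖ ≤ ‖z‖)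
    (hZf : ∀ᶠ z in 𝓝[≠] 0, Z z = z * F₂ (z * F₁ (Z z)))
    (hWf : ∀ᶠ z in 𝓝[≠] 0, W z = z * F₂ (z * F₁ (W z))) : EqOn W Z unitDisk := by
  obtain ⟨L, δ, hL, hδ, hδ1, hc⟩ := local_contr hF₁ hF₂ hb₁
  have h0 : (0 : ℂ) ∈ unitDisk := by simp [mem_uD]
  refine (hW.analyticOnNhd isOpen_uD).eqOn_of_preconnected_of_frequently_eq
    (hZ.analyticOnNhd isOpen_uD) (convex_ball _ _).isPreconnected h0 (Eventually.frequently ?_)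
  have hb : Metric.ball (0 : ℂ) (min δ (1 / (L + 1))) ∈ 𝓝[≠] (0 : ℂ) :=
    mem_nhdsWithin_of_mem_nhds (Metric.ball_mem_nhds _ (by positivity))
  filter_upwards [hZf, hWf, hb] with z hz hw hzb
  rw [mem_ball_zero_iff, lt_min_iff, lt_div_iff₀ (by positivity)] at hzb
  have hzu : z ∈ unitDisk := mem_uD.2 (by linarith)
  have := hc z _ _ hzb.1 (hWn z hzu) (hZn z hzu)
  rw [← hz, ← hw] at this
  have hn := norm_nonneg (W z - Z z)
  have hnz := norm_nonneg z
  have h3 : ‖W z - Z z‖ = 0 := by nlinarith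
  exact sub_eq_zero.1 (norm_eq_zero.1 h3)

/-! ### The functions Q -/

lemma ae_norm {μ : Measure ℂ} (h : MStar μ) : ∀ᵐ ξ ∂μ, ‖ξ‖ = 1 := by
  have := h.2.1
  rw [← mem_ae_iff] at this
  filter_upwards [this] with ξ hξ
  simpa using hξ

noncomputable def hStar (μ : Measure ℂ) (z : ℂ) : ℂ := ∫ ξ, ξ / (1 - z * ξ) ∂μ

lemma norm_one_sub {z ξ : ℂ} (hξ : ‖ξ‖ = 1) : 1 - ‖z‖ ≤ ‖1 - z * ξ‖ := by
  have := norm_sub_norm_le (1 : ℂ) (z * ξ)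
  simpa [hξ] using this

lemma meas_kernel {μ : Measure ℂ} (z : ℂ) :
    AEStronglyMeasurable (fun ξ : ℂ => ξ / (1 - z * ξ)) μ :=
  Measurable.aestronglyMeasurable (by fun_prop)

lemma int_kernel {μ : Measure ℂ} (h : MStar μ) {z : ℂ} (hz : z ∈ unitDisk) :
    Integrable (fun ξ : ℂ => ξ / (1 - z * ξ)) μ := by
  have := h.1
  have hz := mem_uD.1 hz
  refine Integrable.of_bound (meas_kernel z) (1 / (1 - ‖z‖)) ?_
  filter_upwards [ae_norm h] with ξ hξ
  rw [norm_div, hξ]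
  have := norm_one_sub (z := z) hξ
  gcongr

lemma psi_eq {μ : Measure ℂ} (z : ℂ) : psiStar μ z = z * hStar μ z := by
  rw [psiStar, hStar, ← integral_const_mul]
  simp_rw [mul_div_assoc]

lemma hStar_zero {μ : Measure ℂ} : hStar μ 0 = ∫ ξ, ξ ∂μ := by simp [hStar]

lemma hStar_diff {μ : Measure ℂ} (h : MStar μ) : DifferentiableOn ℂ (hStar μ) unitDisk := by
  have := h.1
  intro z hz
  obtain ⟨r, hr1, hr2⟩ := exists_between (mem_uD.1 hz)
  have hs : Metric.ball (0 : ℂ) r ∈ 𝓝 z := Metric.isOpen_ball.mem_nhds (by simpa using hr1)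
  have key := hasDerivAt_integral_of_dominated_loc_of_deriv_le (μ := μ)
    (F := fun z ξ : ℂ => ξ / (1 - z * ξ)) (F' := fun z ξ : ℂ => ξ * ξ / (1 - z * ξ) ^ 2)
    (bound := fun _ => 1 / (1 - r) ^ 2) hs (Eventually.of_forall fun z => meas_kernel z)
    (int_kernel h hz) (Measurable.aestronglyMeasurable (by fun_prop)) ?_ (integrable_const _) ?_
  · exact key.2.differentiableAt.differentiableWithinAt
  · filter_upwards [ae_norm h] with ξ hξ w hw
    have hw : ‖w‖ < r := by simpa using hw
    have := norm_one_sub (z := w) hξ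
    rw [norm_div, norm_mul, norm_pow, hξ, one_mul]
    have : 0 < 1 - r := by linarith
    gcongr
    linarith
  · filter_upwards [ae_norm h] with ξ hξ w hw
    have hw : ‖w‖ < r := by simpa using hw
    have := norm_one_sub (z := w) hξ
    have hne : 1 - w * ξ ≠ 0 := by
      intro h0; rw [h0, norm_zero] at this; linarith
    have h1 : HasDerivAt (fun w : ℂ => 1 - w * ξ) (-ξ) w := by
      simpa using ((hasDerivAt_id w).mul_const ξ).const_sub 1
    have h2 := (hasDerivAt_const w ξ).div h1 hne
    refine h2.congr_deriv ?_
    congr 1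
    ring

lemma re_kernel {x : ℂ} (hx : ‖x‖ < 1) : -(1/2) ≤ (x / (1 - x)).re := by
  have hne : 1 - x ≠ 0 := by
    intro h0
    rw [← sub_eq_zero.1 h0] at hx; simp at hx
  have hp : 0 < normSq (1 - x) := normSq_pos.2 hne
  have hx2 : normSq x < 1 := by
    rw [normSq_eq_norm_sq]; nlinarith [norm_nonneg x]
  rw [Complex.div_re, ← add_div, le_div_iff₀ hp]
  simp only [normSq_apply, sub_re, sub_im, one_re, one_im] at *
  nlinarith

lemma psi_re {μ : Measure ℂ} (h : MStar μ) {z : ℂ} (hz : z ∈ unitDisk) :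
    -(1/2) ≤ (psiStar μ z).re := by
  have := h.1
  have hi : Integrable (fun ξ : ℂ => (z * ξ) / (1 - z * ξ)) μ := by
    simpa only [mul_div_assoc] using (int_kernel h hz).const_mul z
  have e : (psiStar μ z).re = ∫ ξ, ((z * ξ) / (1 - z * ξ)).re ∂μ := by
    exact (integral_re hi).symm
  rw [e]
  have := integral_mono_ae (integrable_const (-(1/2) : ℝ)) hi.re (by
    filter_upwards [ae_norm h] with ξ hξ
    exact re_kernel (by simpa [hξ] using mem_uD.1 hz))
  simpa using this

noncomputable def FStar (μ : Measure ℂ) (z : ℂ) : ℂ := hStar μ z / (1 + z * hStar μ z)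

lemma Q_eq {μ : Measure ℂ} (z : ℂ) : QStar μ z = z * FStar μ z := by
  rw [QStar, FStar, psi_eq, mul_div_assoc]

lemma one_add_ne {μ : Measure ℂ} (h : MStar μ) {z : ℂ} (hz : z ∈ unitDisk) :
    1 + psiStar μ z ≠ 0 := by
  intro h0
  have h1 := congrArg Complex.re h0
  have := psi_re h hz
  simp at h1
  linarith

lemma FStar_diff {μ : Measure ℂ} (h : MStar μ) : DifferentiableOn ℂ (FStar μ) unitDisk := by
  refine (hStar_diff h).div ((differentiableOn_const 1).add
    (differentiableOn_id.mul (hStar_diff h))) fun z hz => ?_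
  have := one_add_ne h hz
  rwa [psi_eq] at this

lemma FStar_zero {μ : Measure ℂ} (h : MStar μ) : FStar μ 0 ≠ 0 := by
  simpa [FStar, hStar_zero] using h.2.2

lemma Q_norm {μ : Measure ℂ} (h : MStar μ) {z : ℂ} (hz : z ∈ unitDisk) : ‖QStar μ z‖ ≤ 1 := by
  rw [QStar, norm_div]
  refine div_le_one_of_le₀ ?_ (norm_nonneg _)
  have := psi_re h hz
  refine abs_le_of_sq_le_sq' ?_ (norm_nonneg _) |>.2
  rw [← normSq_eq_norm_sq, ← normSq_eq_norm_sq]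
  simp only [normSq_apply, add_re, add_im, one_re, one_im]
  nlinarith

lemma deriv_mul_zero {g : ℂ → ℂ} (hg : DifferentiableOn ℂ g unitDisk) :
    deriv (fun z => z * g z) 0 = g 0 := by
  have h0 : unitDisk ∈ 𝓝 (0 : ℂ) := isOpen_uD.mem_nhds (by simp [mem_uD])
  have := (hasDerivAt_id (0 : ℂ)).mul (hg.differentiableAt h0).hasDerivAt
  have h2 : HasDerivAt (fun z => z * g z) (g 0) 0 := by
    refine HasDerivAt.congr_deriv this ?_
    simp
  exact h2.deriv

lemma FStar_norm {μ : Measure ℂ} (h : MStar μ) {z : ℂ} (hz : z ∈ unitDisk) :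
    ‖FStar μ z‖ ≤ 1 := by
  have hQ : (QStar μ) = fun z => z * FStar μ z := funext Q_eq
  have hd : DifferentiableOn ℂ (QStar μ) (Metric.ball 0 1) := by
    rw [hQ]; exact differentiableOn_id.mul (FStar_diff h)
  have := Complex.norm_dslope_le_div_of_mapsTo_ball (R₂ := 1) hd (fun w hw => by
    have : ‖QStar μ w‖ ≤ 1 := Q_norm h hw
    simpa [Q_eq 0] using this) hz
  rw [div_one] at this
  rcases eq_or_ne z 0 with rfl | hne
  · rwa [dslope_same, hQ, deriv_mul_zero (FStar_diff h)] at this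
  · rw [dslope_of_ne _ hne, slope_def_field, Q_eq, Q_eq] at this
    simpa [hne] using this

lemma schurStar_norm {W : ℂ → ℂ} (hW : schurStar W) {z : ℂ} (hz : z ∈ unitDisk) :
    ‖W z‖ ≤ ‖z‖ :=
  Complex.norm_le_norm_of_mapsTo_ball (R := 1) hW.1
    (fun w hw => by simpa using hW.2.1 w hw) hW.2.2.1 (mem_uD.1 hz)

lemma schurStar_ne {W : ℂ → ℂ} (hW : schurStar W) : ∀ᶠ z in 𝓝[≠] 0, W z ≠ 0 := by
  have h0 : unitDisk ∈ 𝓝 (0 : ℂ) := isOpen_uD.mem_nhds (by simp [mem_uD])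
  have := (hW.1.differentiableAt h0).hasDerivAt.eventually_ne (c := W 0) hW.2.2.2
  rwa [hW.2.2.1] at this

/-- Theorem 2.7: existence and uniqueness of subordination functions for
multiplicative free convolution on the unit circle. -/
theorem multiplicative_subordination_circle (μ₁ μ₂ : Measure ℂ)
    (h₁ : MStar μ₁) (h₂ : MStar μ₂) :
    ∃ Z₁ Z₂ : ℂ → ℂ, schurStar Z₁ ∧ schurStar Z₂ ∧
      (∀ z ∈ unitDisk,
        Z₁ z * Z₂ z = z * QStar μ₁ (Z₁ z) ∧ QStar μ₁ (Z₁ z) = QStar μ₂ (Z₂ z)) ∧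
      (∀ W₁ W₂ : ℂ → ℂ, schurStar W₁ → schurStar W₂ →
        (∀ z ∈ unitDisk,
          W₁ z * W₂ z = z * QStar μ₁ (W₁ z) ∧ QStar μ₁ (W₁ z) = QStar μ₂ (W₂ z)) →
        ∀ z ∈ unitDisk, W₁ z = Z₁ z ∧ W₂ z = Z₂ z) := by
  obtain ⟨Z, hZd, hZn, hZf⟩ := exists_fix (FStar_diff h₁) (FStar_diff h₂)
    (fun z hz => FStar_norm h₁ hz) (fun z hz => FStar_norm h₂ hz)
  have h0 : (0 : ℂ) ∈ unitDisk := by simp [mem_uD]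
  have hZ0 : Z 0 = 0 := by simpa using hZn 0 h0
  have hZu : ∀ z ∈ unitDisk, Z z ∈ unitDisk := fun z hz =>
    mem_uD.2 ((hZn z hz).trans_lt (mem_uD.1 hz))
  have hcd := comp_diff (FStar_diff h₁) (FStar_diff h₂) (fun z hz => FStar_norm h₁ hz) hZd hZn
  refine ⟨Z, fun z => z * FStar μ₁ (Z z), ⟨hZd, ?_, hZ0, ?_⟩, ⟨hcd.1, ?_, by simp, ?_⟩, ?_, ?_⟩
  · exact fun z hz => (hZn z hz).trans (mem_uD.1 hz).le
  · have he : Z =ᶠ[𝓝 0] fun z => z * FStar μ₂ (z * FStar μ₁ (Z z)) := by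
      filter_upwards [isOpen_uD.mem_nhds h0] with z hz using hZf z hz
    rw [he.deriv_eq, deriv_mul_zero hcd.2]
    simpa using FStar_zero h₂
  · exact fun z hz => (mul_mem_uD (fun z hz => FStar_norm h₁ hz) (hZu z hz)).trans
      (mem_uD.1 hz).le
  · have hd := deriv_mul_zero (g := fun z => FStar μ₁ (Z z)) ((FStar_diff h₁).comp hZd hZu)
    rw [hd, hZ0]
    exact FStar_zero h₁
  · intro z hz
    have hf := hZf z hz
    simp only [Q_eq]
    refine ⟨by ring, ?_⟩
    calc Z z * FStar μ₁ (Z z)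
        = (z * FStar μ₂ (z * FStar μ₁ (Z z))) * FStar μ₁ (Z z) := by rw [← hf]
      _ = _ := by ring
  · intro W₁ W₂ hW₁ hW₂ hW
    have hnear : ∀ᶠ z in 𝓝[≠] (0 : ℂ), W₂ z = z * FStar μ₁ (W₁ z) ∧
        W₁ z = z * FStar μ₂ (W₂ z) := by
      filter_upwards [schurStar_ne hW₁, schurStar_ne hW₂,
        mem_nhdsWithin_of_mem_nhds (isOpen_uD.mem_nhds h0)] with z n1 n2 hz
      obtain ⟨e1, e2⟩ := hW z hz
      constructor
      · apply mul_left_cancel₀ n1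
        rw [e1, Q_eq]; ring
      · apply mul_left_cancel₀ n2
        rw [mul_comm, e1, e2, Q_eq]; ring
    have hE : EqOn W₁ Z unitDisk := by
      refine fix_unique (FStar_diff h₁) (FStar_diff h₂) (fun z hz => FStar_norm h₁ hz) hZd hW₁.1 hZn
        (fun z hz => schurStar_norm hW₁ hz) ?_ ?_
      · filter_upwards [mem_nhdsWithin_of_mem_nhds (isOpen_uD.mem_nhds h0)] with z hz
          using hZf z hz
      · filter_upwards [hnear] with z hz
        rw [← hz.1]; exact hz.2
    have hE2 : EqOn W₂ (fun z => z * FStar μ₁ (Z z)) unitDisk := by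
      refine (hW₂.1.analyticOnNhd isOpen_uD).eqOn_of_preconnected_of_frequently_eq
        (hcd.1.analyticOnNhd isOpen_uD) (convex_ball _ _).isPreconnected h0
        (Eventually.frequently ?_)
      filter_upwards [hnear, mem_nhdsWithin_of_mem_nhds (isOpen_uD.mem_nhds h0)] with z hz hzu
      rw [hz.1, hE hzu]
    exact fun z hz => ⟨hE hz, hE2 hz⟩
end

section
/- Let g : ℂ⁺ → ℂ⁻ be an analytic function mapping the open upper half-plane into the open lower half-plane, and suppose liminf_{y → +∞} |g(iy)|/y = 0. Then the function f(z) = z + g(z) takes every value in ℂ⁺ precisely once; that is, for every w ∈ ℂ⁺ there is a unique z ∈ ℂ⁺ with z + g(z) = w. Moreover, the inverse map f^{(−1)} : ℂ⁺ → ℂ⁺ thus defined belongs to the class 𝓕, i.e. it is the reciprocal Cauchy transform of some Borel probability measure on ℝ. -/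
open MeasureTheory Complex Filter Set

open scoped ComplexConjugate Topology

namespace MaassenAux

lemma isOpen_upperHalf : IsOpen upperHalf := isOpen_lt continuous_const Complex.continuous_im

lemma norm_sub_conj_sq (a b : ℂ) : ‖a - conj b‖ ^ 2 = ‖a - b‖ ^ 2 + 4 * (a.im * b.im) := by
  rw [← Complex.normSq_eq_norm_sq, ← Complex.normSq_eq_norm_sq, Complex.normSq_apply,
    Complex.normSq_apply]
  simp
  ring

lemma sub_conj_ne {a b : ℂ} (ha : 0 < a.im) (hb : 0 < b.im) : a - conj b ≠ 0 := by
  intro h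
  have := congrArg Complex.im h
  simp at this
  linarith

lemma im_psi (ζ u : ℂ) (hu : ‖u‖ < 1) (hζ : 0 < ζ.im) :
    0 < ((ζ - conj ζ * u) / (1 - u)).im := by
  have h1 : 1 - u ≠ 0 := by
    intro h
    have : u = 1 := by linear_combination -h
    rw [this] at hu
    simp at hu
  have h2 : 0 < Complex.normSq (1 - u) := Complex.normSq_pos.2 h1
  have h3 : Complex.normSq u < 1 := by
    rw [Complex.normSq_eq_norm_sq]
    nlinarith [norm_nonneg u]
  have h4 : ((ζ - conj ζ * u) / (1 - u)).im
      = ζ.im * (1 - Complex.normSq u) / Complex.normSq (1 - u) := by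
    rw [Complex.div_im, Complex.normSq_apply u]
    simp
    field_simp
    ring
  rw [h4]
  have : 0 < 1 - Complex.normSq u := by linarith
  positivity

/-- Schwarz-Pick in the half-plane. -/
lemma schwarz_pick {h : ℂ → ℂ} (hd : DifferentiableOn ℂ h upperHalf)
    (hm : ∀ z ∈ upperHalf, 0 < (h z).im) {z ζ : ℂ} (hz : z ∈ upperHalf) (hζ : ζ ∈ upperHalf) :
    ‖h z - h ζ‖ ^ 2 * (z.im * ζ.im) ≤ ‖z - ζ‖ ^ 2 * ((h z).im * (h ζ).im) := by
  have hz' : 0 < z.im := hz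
  have hζ' : 0 < ζ.im := hζ
  set ψ : ℂ → ℂ := fun u => (ζ - conj ζ * u) / (1 - u) with hψ
  set k : ℂ → ℂ := fun u => (h (ψ u) - h ζ) / (h (ψ u) - conj (h ζ)) with hk
  have hψm : ∀ u ∈ Metric.ball (0 : ℂ) 1, ψ u ∈ upperHalf := by
    intro u hu
    exact im_psi ζ u (by simpa using hu) hζ
  have h1u : ∀ u ∈ Metric.ball (0 : ℂ) 1, 1 - u ≠ 0 := by
    intro u hu h
    have : u = 1 := by linear_combination -h
    rw [this] at hu
    simp at hu
  have hψd : DifferentiableOn ℂ ψ (Metric.ball 0 1) := by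
    apply DifferentiableOn.div
    · fun_prop
    · fun_prop
    · exact h1u
  have hhψ : DifferentiableOn ℂ (fun u => h (ψ u)) (Metric.ball 0 1) := hd.comp hψd hψm
  have hkd : DifferentiableOn ℂ k (Metric.ball 0 1) := by
    apply DifferentiableOn.div
    · exact hhψ.sub_const _
    · exact hhψ.sub_const _
    · intro u hu
      exact sub_conj_ne (hm _ (hψm u hu)) (hm _ hζ)
  have hkm : MapsTo k (Metric.ball 0 1) (Metric.closedBall 0 1) := by
    intro u hu
    have a1 := hm _ (hψm u hu)
    have a2 := hm _ hζ
    have a3 := sub_conj_ne a1 a2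
    simp only [hk, mem_closedBall_zero_iff, norm_div]
    rw [div_le_one (norm_pos_iff.2 a3)]
    apply le_of_sq_le_sq _ (norm_nonneg _)
    rw [norm_sub_conj_sq]
    nlinarith [mul_pos a1 a2]
  have hk0 : k 0 = 0 := by simp [hk, hψ]
  have hne := sub_conj_ne hz' hζ'
  have hne2 := sub_conj_ne (hm _ hz) (hm _ hζ)
  set u₀ := (z - ζ) / (z - conj ζ) with hu₀
  have hu₀n : ‖u₀‖ < 1 := by
    rw [hu₀, norm_div, div_lt_one (norm_pos_iff.2 hne)]
    apply lt_of_pow_lt_pow_left₀ 2 (norm_nonneg _)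
    rw [norm_sub_conj_sq]
    nlinarith [mul_pos hz' hζ']
  have hψu : ψ u₀ = z := by
    have h1 : 1 - u₀ ≠ 0 := h1u _ (by simpa using hu₀n)
    simp only [hψ]
    rw [div_eq_iff h1, hu₀]
    field_simp
    ring
  have key := Complex.norm_le_norm_of_mapsTo_ball hkd hkm hk0 hu₀n
  simp only [hk, hψu] at key
  rw [hu₀, norm_div, norm_div, div_le_div_iff₀ (norm_pos_iff.2 hne2) (norm_pos_iff.2 hne)] at key
  have key2 := mul_self_le_mul_self (by positivity) key
  have e1 := norm_sub_conj_sq z ζ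
  have e2 := norm_sub_conj_sq (h z) (h ζ)
  have key3 : ‖h z - h ζ‖ ^ 2 * ‖z - conj ζ‖ ^ 2 ≤ ‖z - ζ‖ ^ 2 * ‖h z - conj (h ζ)‖ ^ 2 := by
    nlinarith
  rw [e1, e2] at key3
  linarith

lemma fixed_unique {h : ℂ → ℂ} (hd : DifferentiableOn ℂ h upperHalf)
    (hm : ∀ z ∈ upperHalf, 0 < (h z).im) {w z ζ : ℂ} (hw : w ∈ upperHalf)
    (hz : z ∈ upperHalf) (hζ : ζ ∈ upperHalf) (ez : z = w + h z) (eζ : ζ = w + h ζ) : z = ζ := by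
  have hsp := schwarz_pick hd hm hz hζ
  have e : h z - h ζ = z - ζ := by linear_combination -ez + eζ
  rw [e] at hsp
  by_contra hne
  have hp : 0 < ‖z - ζ‖ ^ 2 := by
    have := norm_pos_iff.2 (sub_ne_zero.2 hne)
    positivity
  have h1 : z.im = w.im + (h z).im := by rw [← Complex.add_im, ← ez]
  have h2 : ζ.im = w.im + (h ζ).im := by rw [← Complex.add_im, ← eζ]
  have hw' : 0 < w.im := hw
  have a1 := hm z hz
  have a2 := hm ζ hζ
  have := le_of_mul_le_mul_left hsp hp
  rw [h1, h2] at this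
  nlinarith [mul_pos hw' a1, mul_pos hw' a2, mul_pos hw' hw']

lemma deriv_ne_one {h : ℂ → ℂ} (hd : DifferentiableOn ℂ h upperHalf)
    (hm : ∀ z ∈ upperHalf, 0 < (h z).im) {z : ℂ} (hz : z ∈ upperHalf)
    (hlt : (h z).im < z.im) : deriv h z ≠ 1 := by
  intro h1
  have hz' : 0 < z.im := hz
  have hda : DifferentiableAt ℂ h z := hd.differentiableAt (isOpen_upperHalf.mem_nhds hz)
  have hs := hasDerivAt_iff_tendsto_slope.1 hda.hasDerivAt
  rw [h1] at hs
  have hs2 : Tendsto (fun x => ‖slope h z x‖ ^ 2 * (x.im * z.im)) (𝓝[≠] z)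
      (𝓝 (‖(1 : ℂ)‖ ^ 2 * (z.im * z.im))) := by
    refine (hs.norm.pow 2).mul (Tendsto.mul_const _ ?_)
    exact (Complex.continuous_im.tendsto z).mono_left nhdsWithin_le_nhds
  have hs3 : Tendsto (fun x => (h x).im * (h z).im) (𝓝[≠] z) (𝓝 ((h z).im * (h z).im)) := by
    refine Tendsto.mul_const _ ?_
    exact ((Complex.continuous_im.tendsto _).comp hda.continuousAt).mono_left nhdsWithin_le_nhds
  have hle : ∀ᶠ x in 𝓝[≠] z, ‖slope h z x‖ ^ 2 * (x.im * z.im) ≤ (h x).im * (h z).im := by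
    filter_upwards [self_mem_nhdsWithin,
      mem_nhdsWithin_of_mem_nhds (isOpen_upperHalf.mem_nhds hz)] with x hx hxu
    have hp : 0 < ‖x - z‖ := norm_pos_iff.2 (sub_ne_zero.2 hx)
    have := schwarz_pick hd hm hxu hz
    rw [slope_def_field, norm_div, div_pow, div_mul_eq_mul_div, div_le_iff₀ (by positivity)]
    linarith
  have := le_of_tendsto_of_tendsto hs2 hs3 hle
  have a := hm z hz
  simp at this
  nlinarith

lemma exists_fixed_bounded {h : ℂ → ℂ} (hd : DifferentiableOn ℂ h upperHalf)
    (hm : ∀ z ∈ upperHalf, 0 < (h z).im) {B : ℝ} (hB : ∀ z ∈ upperHalf, ‖h z‖ ≤ B)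
    {w : ℂ} (hw : w ∈ upperHalf) : ∃ z ∈ upperHalf, z = w + h z := by
  have hw' : 0 < w.im := hw
  let Z : ℕ → ℂ := fun n => Nat.rec w (fun _ z => w + h z) n
  have Zs : ∀ n, Z (n + 1) = w + h (Z n) := fun n => rfl
  have Zc : ∀ n, w.im ≤ (Z n).im := by
    intro n
    induction n with
    | zero => exact le_rfl
    | succ n ih =>
      rw [Zs, Complex.add_im]
      have := hm (Z n) (lt_of_lt_of_le hw' ih)
      linarith
  have Zu : ∀ n, Z n ∈ upperHalf := fun n => lt_of_lt_of_le hw' (Zc n)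
  have hB0 : 0 ≤ B := (norm_nonneg _).trans (hB w hw)
  set M := w.im + B with hM
  have hMpos : 0 < M := by linarith
  have ZM : ∀ n, (Z n).im ≤ M := by
    intro n
    cases n with
    | zero => change w.im ≤ M; linarith
    | succ n =>
      rw [Zs, Complex.add_im]
      have := (Complex.abs_im_le_norm (h (Z n))).trans (hB _ (Zu n))
      have := (abs_le.1 this).2
      linarith
  set q := 1 - w.im / M with hq
  have hq1 : q < 1 := by
    have : 0 < w.im / M := by positivity
    linarith
  have hq0 : 0 ≤ q := by
    have : w.im / M ≤ 1 := by rw [div_le_one hMpos]; linarith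
    linarith
  have hqy : ∀ y, y ≤ M → y - w.im ≤ q * y := by
    intro y hy
    have : w.im / M * y ≤ w.im := by
      rw [div_mul_eq_mul_div, div_le_iff₀ hMpos]
      exact mul_le_mul_of_nonneg_left hy hw'.le
    rw [hq]; linarith
  set e : ℕ → ℝ := fun n => ‖Z (n + 1) - Z n‖ ^ 2 / ((Z (n + 1)).im * (Z n).im) with he
  have Zp : ∀ n, 0 < (Z n).im := Zu
  have estep : ∀ n, e (n + 1) ≤ q ^ 2 * e n := by
    intro n
    have hsp := schwarz_pick hd hm (Zu (n + 1)) (Zu n)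
    have e1 : h (Z (n + 1)) - h (Z n) = Z (n + 2) - Z (n + 1) := by
      rw [Zs (n + 1), Zs n]; ring
    have i1 : (h (Z (n + 1))).im = (Z (n + 2)).im - w.im := by rw [Zs (n + 1)]; simp
    have i2 : (h (Z n)).im = (Z (n + 1)).im - w.im := by rw [Zs n]; simp
    have p1 := hm _ (Zu n)
    have p2 := hm _ (Zu (n + 1))
    rw [e1, i1, i2] at hsp
    rw [i2] at p1
    rw [i1] at p2
    have a1 := hqy _ (ZM (n + 1))
    have a2 := hqy _ (ZM (n + 2))
    have a3 : ((Z (n + 2)).im - w.im) * ((Z (n + 1)).im - w.im)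
        ≤ (q * (Z (n + 2)).im) * (q * (Z (n + 1)).im) :=
      mul_le_mul a2 a1 p1.le (by have := Zp (n + 2); positivity)
    simp only [he]
    have b0 := Zp n
    have b1 := Zp (n + 1)
    have b2 := Zp (n + 2)
    rw [← mul_div_assoc, div_le_div_iff₀ (by positivity) (by positivity)]
    refine hsp.trans ((mul_le_mul_of_nonneg_left a3 (by positivity)).trans (le_of_eq ?_))
    ring
  have egeo : ∀ n, e n ≤ (q ^ 2) ^ n * e 0 := by
    intro n
    induction n with
    | zero => simp
    | succ n ih =>
      refine (estep n).trans ((mul_le_mul_of_nonneg_left ih (by positivity)).trans (le_of_eq ?_))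
      ring
  have e0 : 0 ≤ e 0 := by
    have := Zp 0
    have := Zp 1
    simp only [he]
    positivity
  have dgeo : ∀ n, dist (Z n) (Z (n + 1)) ≤ (Real.sqrt (e 0) * M) * q ^ n := by
    intro n
    rw [dist_comm, dist_eq_norm]
    apply le_of_sq_le_sq _ (by positivity)
    have b0 := Zp n
    have b1 := Zp (n + 1)
    have h1 : ‖Z (n + 1) - Z n‖ ^ 2 = e n * ((Z (n + 1)).im * (Z n).im) := by
      simp only [he]; field_simp
    rw [h1, mul_pow, mul_pow, Real.sq_sqrt e0]
    have h2 : (Z (n + 1)).im * (Z n).im ≤ M * M := mul_le_mul (ZM (n + 1)) (ZM n) b0.le hMpos.le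
    calc e n * ((Z (n + 1)).im * (Z n).im) ≤ ((q ^ 2) ^ n * e 0) * (M * M) :=
          mul_le_mul (egeo n) h2 (by positivity) (by positivity)
      _ = _ := by rw [← pow_mul, ← pow_mul, mul_comm 2 n]; ring
  have hcs := cauchySeq_of_le_geometric q _ hq1 dgeo
  obtain ⟨a, ha⟩ := cauchySeq_tendsto_of_complete hcs
  have hac : w.im ≤ a.im :=
    ge_of_tendsto' ((Complex.continuous_im.tendsto a).comp ha) Zc
  have hau : a ∈ upperHalf := lt_of_lt_of_le hw' hac
  refine ⟨a, hau, ?_⟩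
  have hca : ContinuousAt h a := (hd.differentiableAt (isOpen_upperHalf.mem_nhds hau)).continuousAt
  have t1 : Tendsto (fun n => Z (n + 1)) atTop (𝓝 (w + h a)) := by
    simp only [Zs]
    exact (hca.tendsto.comp ha).const_add w
  exact tendsto_nhds_unique (ha.comp (tendsto_add_atTop_nat 1)) t1

lemma im_reg {a : ℂ} (ha : 0 < a.im) {ε : ℝ} (hε : 0 < ε) :
    (a⁻¹ - ε * I).im < -ε ∧ a⁻¹ - ε * I ≠ 0 ∧ 0 < ((a⁻¹ - ε * I)⁻¹).im
      ∧ ‖(a⁻¹ - ε * I)⁻¹‖ ≤ ε⁻¹ := by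
  have ha0 : a ≠ 0 := by rintro rfl; simp at ha
  have hn : 0 < Complex.normSq a := Complex.normSq_pos.2 ha0
  have h1 : (a⁻¹ - ε * I).im < -ε := by
    have : 0 < a.im / Complex.normSq a := by positivity
    simp [Complex.inv_im]
    rw [neg_div]
    linarith
  have h2 : a⁻¹ - ε * I ≠ 0 := by
    intro h
    rw [h] at h1
    simp at h1
    linarith
  refine ⟨h1, h2, ?_, ?_⟩
  · rw [Complex.inv_im]
    exact div_pos (by linarith) (Complex.normSq_pos.2 h2)
  · rw [norm_inv]
    apply inv_anti₀ hε
    have := Complex.abs_im_le_norm (a⁻¹ - ε * I)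
    rw [abs_of_neg (by linarith)] at this
    linarith

lemma exists_fixed {h : ℂ → ℂ} (hd : DifferentiableOn ℂ h upperHalf)
    (hm : ∀ z ∈ upperHalf, 0 < (h z).im)
    (hs : ∀ ε > 0, ∃ᶠ y : ℝ in atTop, ‖h ((y : ℂ) * I)‖ < ε * y)
    {w : ℂ} (hw : w ∈ upperHalf) : ∃ z ∈ upperHalf, z = w + h z := by
  have hw' : 0 < w.im := hw
  set ε : ℕ → ℝ := fun n => 1 / ((n : ℝ) + 1) with hε
  have εp : ∀ n, 0 < ε n := fun n => by simp only [hε]; positivity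
  have εt : Tendsto ε atTop (𝓝 0) := tendsto_one_div_add_atTop_nhds_zero_nat
  set k : ℕ → ℂ → ℂ := fun n z => ((h z)⁻¹ - ε n * I)⁻¹ with hk
  have kd : ∀ n, DifferentiableOn ℂ (k n) upperHalf := by
    intro n
    apply DifferentiableOn.inv
    · apply DifferentiableOn.sub_const
      apply hd.inv
      intro z hz h0
      have := hm z hz
      rw [h0] at this
      simp at this
    · intro z hz
      exact (im_reg (hm z hz) (εp n)).2.1
  have km : ∀ n, ∀ z ∈ upperHalf, 0 < (k n z).im :=
    fun n z hz => (im_reg (hm z hz) (εp n)).2.2.1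
  have kB : ∀ n, ∀ z ∈ upperHalf, ‖k n z‖ ≤ (ε n)⁻¹ :=
    fun n z hz => (im_reg (hm z hz) (εp n)).2.2.2
  have ex : ∀ n, ∃ z ∈ upperHalf, z = w + k n z :=
    fun n => exists_fixed_bounded (kd n) (km n) (kB n) hw
  choose Z Zu Ze using ex
  have Zc : ∀ n, w.im ≤ (Z n).im := by
    intro n
    have := km n _ (Zu n)
    rw [Ze n, Complex.add_im]
    linarith
  have hne : ∀ z ∈ upperHalf, h z ≠ 0 := by
    intro z hz h0
    have := hm z hz
    rw [h0] at this
    simp at this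
  -- convergence of the regularisation
  have klim : ∀ (φ : ℕ → ℕ) (x : ℕ → ℂ) (a : ℂ), Tendsto φ atTop atTop → Tendsto x atTop (𝓝 a) →
      a ∈ upperHalf → Tendsto (fun n => k (φ n) (x n)) atTop (𝓝 (h a)) := by
    intro φ x a hφ hx ha
    have hca : ContinuousAt h a :=
      (hd.differentiableAt (isOpen_upperHalf.mem_nhds ha)).continuousAt
    have t1 : Tendsto (fun n => (h (x n))⁻¹ - (ε (φ n) : ℂ) * I) atTop
        (𝓝 ((h a)⁻¹ - ((0 : ℝ) : ℂ) * I)) := by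
      apply Tendsto.sub
      · exact (hca.tendsto.comp hx).inv₀ (hne a ha)
      · apply Tendsto.mul_const
        exact (Complex.continuous_ofReal.tendsto 0).comp (εt.comp hφ)
    have t2 := t1.inv₀ (by simpa using hne a ha)
    simpa using t2
  by_cases hb : Tendsto (fun n => ‖Z n‖) atTop atTop
  · exfalso
    have hy : ∀ y : ℝ, 0 < y → y ≤ w.im + (h (y * I)).im := by
      intro y hy
      have hzu : (y : ℂ) * I ∈ upperHalf := by simpa [upperHalf] using hy
      set z : ℂ := (y : ℂ) * I with hz
      have hzim : z.im = y := by simp [hz]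
      have kl := klim id (fun _ => z) z tendsto_id tendsto_const_nhds hzu
      simp only [id] at kl
      have hinv : Tendsto (fun n => (Z n)⁻¹) atTop (𝓝 0) :=
        tendsto_inv₀_cobounded.comp (tendsto_norm_atTop_iff_cobounded.1 hb)
      have t1 : Tendsto (fun n => ‖(w + k n z) * (Z n)⁻¹ - 1‖ ^ 2 * y) atTop
          (𝓝 (‖(w + h z) * 0 - 1‖ ^ 2 * y)) :=
        (((((kl.const_add w).mul hinv).sub_const 1).norm).pow 2).mul_const y
      have t2 : Tendsto (fun n => ‖z * (Z n)⁻¹ - 1‖ ^ 2 * (w + k n z).im) atTop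
          (𝓝 (‖z * 0 - 1‖ ^ 2 * (w + h z).im)) :=
        ((((hinv.const_mul z).sub_const 1).norm).pow 2).mul
          ((Complex.continuous_im.tendsto _).comp (kl.const_add w))
      have hle : ∀ n, ‖(w + k n z) * (Z n)⁻¹ - 1‖ ^ 2 * y
          ≤ ‖z * (Z n)⁻¹ - 1‖ ^ 2 * (w + k n z).im := by
        intro n
        have Zp : 0 < (Z n).im := Zu n
        have Zne : Z n ≠ 0 := by
          intro h0
          rw [h0] at Zp
          simp at Zp
        have hsp := schwarz_pick (h := fun z => w + k n z) ((kd n).const_add w)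
          (fun z hz => by
            have := km n z hz
            simp only [Complex.add_im]
            linarith) hzu (Zu n)
        simp only [← Ze n, hzim] at hsp
        have hsp2 : ‖w + k n z - Z n‖ ^ 2 * y ≤ ‖z - Z n‖ ^ 2 * (w + k n z).im := by
          apply le_of_mul_le_mul_right _ Zp
          linarith
        have e1 : (w + k n z) * (Z n)⁻¹ - 1 = (w + k n z - Z n) / Z n := by field_simp
        have e2 : z * (Z n)⁻¹ - 1 = (z - Z n) / Z n := by field_simp
        have Zn : 0 < ‖Z n‖ := norm_pos_iff.2 Zne
        rw [e1, e2, norm_div, norm_div, div_pow, div_pow, div_mul_eq_mul_div, div_mul_eq_mul_div]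
        gcongr
      have := le_of_tendsto_of_tendsto' t1 t2 hle
      simpa using this
    obtain ⟨y, hy1, hy2⟩ := ((hs (1 / 2) (by norm_num)).and_eventually
      (eventually_gt_atTop (2 * w.im))).exists
    have a1 := hy y (by linarith)
    have a2 := (Complex.abs_im_le_norm (h ((y : ℂ) * I)))
    have a3 := (abs_le.1 a2).2
    linarith
  · simp only [tendsto_atTop, not_forall, not_eventually, not_le] at hb
    obtain ⟨R, hR⟩ := hb
    obtain ⟨a, -, φ, hφ, hφa⟩ := tendsto_subseq_of_frequently_bounded
      (Metric.isBounded_closedBall (x := (0 : ℂ)) (r := R)) (x := Z)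
      (hR.mono (fun n hn => by simpa using hn.le))
    have hac : w.im ≤ a.im :=
      ge_of_tendsto' ((Complex.continuous_im.tendsto a).comp hφa) (fun n => Zc _)
    have hau : a ∈ upperHalf := lt_of_lt_of_le hw' hac
    refine ⟨a, hau, ?_⟩
    have t := (klim φ _ a hφ.tendsto_atTop hφa hau).const_add w
    refine tendsto_nhds_unique hφa (t.congr ?_)
    intro n
    exact (Ze (φ n)).symm

lemma poisson_cont {ζ : ℂ} (hζ : ‖ζ‖ < 1) :
    Continuous (fun θ : ℝ => poissonKernel 0 ζ (circleMap 0 1 θ)) := by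
  unfold poissonKernel
  apply Continuous.div
  · fun_prop
  · fun_prop
  · intro θ h0
    have h1 : circleMap 0 1 θ = ζ := by
      simpa [sub_eq_zero] using h0
    have h2 : ‖circleMap 0 1 θ‖ = 1 := by simp
    rw [h1] at h2
    linarith

lemma poisson_bounds {ζ : ℂ} (hζ : ‖ζ‖ < 1) (θ : ℝ) :
    0 ≤ poissonKernel 0 ζ (circleMap 0 1 θ) ∧
      poissonKernel 0 ζ (circleMap 0 1 θ) ≤ 1 / (1 - ‖ζ‖) ^ 2 := by
  have h2 : ‖circleMap 0 1 θ‖ = 1 := by simp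
  have h3 : 1 - ‖ζ‖ ≤ ‖circleMap 0 1 θ - ζ‖ := by
    have := norm_sub_norm_le (circleMap 0 1 θ) ζ
    rwa [h2] at this
  have h4 : 0 < 1 - ‖ζ‖ := by linarith
  unfold poissonKernel
  rw [sub_zero, sub_zero, h2]
  constructor
  · apply div_nonneg _ (by positivity)
    nlinarith [norm_nonneg ζ]
  · have : (1 : ℝ) ^ 2 - ‖ζ‖ ^ 2 ≤ 1 := by nlinarith [norm_nonneg ζ]
    gcongr

lemma herglotz {H : ℂ → ℂ} (hd : DifferentiableOn ℂ H (Metric.ball 0 1))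
    (hp : ∀ z ∈ Metric.ball (0 : ℂ) 1, 0 < (H z).re) :
    ∃ ν : Measure ℝ, IsFiniteMeasure ν ∧ ∀ ζ : ℂ, ‖ζ‖ < 1 →
      ∫ θ, poissonKernel 0 ζ (circleMap 0 1 θ) ∂ν = (H ζ).re := by
  set r : ℕ → ℝ := fun n => 1 - 1 / ((n : ℝ) + 2) with hr
  have r0 : ∀ n, 0 < r n := by
    intro n
    have : 1 / ((n : ℝ) + 2) < 1 := by
      rw [div_lt_one (by positivity)]
      have : (0 : ℝ) ≤ n := by positivity
      linarith
    simp only [hr]; linarith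
  have r1 : ∀ n, r n < 1 := by
    intro n
    have : 0 < 1 / ((n : ℝ) + 2) := by positivity
    simp only [hr]; linarith
  have rt : Tendsto r atTop (𝓝 1) := by
    have h1 : Tendsto (fun n : ℕ => 1 / ((n : ℝ) + 2)) atTop (𝓝 0) := by
      have : Tendsto (fun n : ℕ => (n : ℝ) + 2) atTop atTop :=
        tendsto_atTop_add_const_right _ _ tendsto_natCast_atTop_atTop
      exact this.inv_tendsto_atTop.congr (fun n => by simp)
    have h2 := h1.const_sub 1
    rw [sub_zero] at h2
    exact h2
  have mem : ∀ n, ∀ ζ : ℂ, ‖ζ‖ ≤ 1 → (r n : ℂ) * ζ ∈ Metric.ball (0 : ℂ) 1 := by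
    intro n ζ hζ
    rw [mem_ball_zero_iff, norm_mul, Complex.norm_real, Real.norm_of_nonneg (r0 n).le]
    calc r n * ‖ζ‖ ≤ r n * 1 := mul_le_mul_of_nonneg_left hζ (r0 n).le
      _ < 1 := by linarith [r1 n]
  set Hr : ℕ → ℂ → ℂ := fun n ζ => H ((r n : ℂ) * ζ) with hHr
  have Hrd : ∀ n, DifferentiableOn ℂ (Hr n) (Metric.closedBall 0 1) := by
    intro n
    apply hd.comp (by fun_prop)
    intro ζ hζ
    exact mem n ζ (by simpa using hζ)
  have Hrc : ∀ n, DiffContOnCl ℂ (Hr n) (Metric.ball 0 1) := by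
    intro n
    refine ⟨(Hrd n).mono Metric.ball_subset_closedBall, ?_⟩
    rw [closure_ball _ one_ne_zero]
    exact (Hrd n).continuousOn
  set u : ℕ → ℝ → ℝ := fun n θ => (2 * Real.pi)⁻¹ * (Hr n (circleMap 0 1 θ)).re with hu
  have ucH : ∀ n, Continuous (fun θ => Hr n (circleMap 0 1 θ)) := by
    intro n
    apply (Hrd n).continuousOn.comp_continuous (by fun_prop)
    intro θ
    simp
  have uc : ∀ n, Continuous (u n) := by
    intro n
    exact (Complex.continuous_re.comp (ucH n)).const_mul _
  have u0 : ∀ n θ, 0 ≤ u n θ := by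
    intro n θ
    have := hp _ (mem n (circleMap 0 1 θ) (by simp))
    have hpi := Real.pi_pos
    simp only [hu, hHr]
    positivity
  set m : ℕ → Measure ℝ := fun n =>
    (volume.restrict (Ioc 0 (2 * Real.pi))).withDensity (fun θ => ENNReal.ofReal (u n θ)) with hm
  have mfin : ∀ n, IsFiniteMeasure (m n) := by
    intro n
    apply isFiniteMeasure_withDensity_ofReal
    exact (((uc n).integrableOn_Icc).mono_set Ioc_subset_Icc_self).2
  have mint : ∀ n, ∀ ζ : ℂ, ‖ζ‖ < 1 →
      ∫ θ, poissonKernel 0 ζ (circleMap 0 1 θ) ∂(m n) = (H ((r n : ℂ) * ζ)).re := by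
    intro n ζ hζ
    have key := (Hrc n).circleAverage_poissonKernel_smul (w := ζ) (by simpa using hζ)
    have key2 := congrArg Complex.re key
    rw [Real.circleAverage_def, intervalIntegral.integral_of_le Real.two_pi_pos.le] at key2
    have hint : Integrable (fun θ => (poissonKernel 0 ζ • Hr n) (circleMap 0 1 θ))
        (volume.restrict (Ioc 0 (2 * Real.pi))) := by
      have hc : Continuous (fun θ => (poissonKernel 0 ζ • Hr n) (circleMap 0 1 θ)) := by
        exact (poisson_cont hζ).smul (ucH n)
      exact (hc.integrableOn_Icc).mono_set Ioc_subset_Icc_self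
    have hre := integral_re hint
    rw [Complex.smul_re] at key2
    change _ = (H ((r n : ℂ) * ζ)).re at key2
    rw [← key2]
    change ∫ a in Ioc 0 (2 * Real.pi), ((poissonKernel 0 ζ • Hr n) (circleMap 0 1 a)).re = 
      (∫ a in Ioc 0 (2 * Real.pi), ((poissonKernel 0 ζ • Hr n) (circleMap 0 1 a))).re at hre
    rw [← hre, smul_eq_mul, ← integral_const_mul]
    simp only [hm]
    rw [integral_withDensity_eq_integral_toReal_smul]
    · apply integral_congr_ae
      refine Eventually.of_forall fun θ => ?_
      simp only
      rw [ENNReal.toReal_ofReal (u0 n θ)]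
      simp [hu]
      ring
    · exact (uc n).measurable.ennreal_ofReal
    · exact Eventually.of_forall fun θ => ENNReal.ofReal_lt_top
  let M : ℕ → FiniteMeasure ℝ := fun n => ⟨m n, mfin n⟩
  have hcomp := isCompact_setOfPred_finiteMeasure_le_of_isCompact (E := ℝ) ((H 0).re.toNNReal)
    (isCompact_Icc (a := (0 : ℝ)) (b := 2 * Real.pi))
  have hmemM : ∀ n, M n ∈ {μ : FiniteMeasure ℝ | μ.mass ≤ (H 0).re.toNNReal ∧
      μ (Icc 0 (2 * Real.pi))ᶜ = 0} := by
    intro n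
    constructor
    · have h1 := mint n 0 (by simp)
      have h2 : ∀ θ, poissonKernel 0 0 (circleMap 0 1 θ) = 1 := by
        intro θ; simp [poissonKernel]
      simp only [h2, mul_zero] at h1
      rw [integral_const, smul_eq_mul, mul_one] at h1
      rw [← NNReal.coe_le_coe, Real.coe_toNNReal _ (hp 0 (by simp)).le, ← h1]
      exact le_rfl
    · rw [FiniteMeasure.null_iff_toMeasure_null]
      change m n _ = 0
      simp only [hm]
      apply withDensity_absolutelyContinuous
      rw [Measure.restrict_apply measurableSet_Icc.compl]
      have he : (Icc 0 (2 * Real.pi))ᶜ ∩ Ioc 0 (2 * Real.pi) = ∅ := by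
        ext x
        simp only [mem_inter_iff, mem_compl_iff, mem_empty_iff_false, iff_false, not_and]
        intro hx hx2
        exact hx (Ioc_subset_Icc_self hx2)
      rw [he, measure_empty]
  obtain ⟨ν, -, hν⟩ := hcomp.exists_mapClusterPt (f := (atTop : Filter ℕ)) (u := M)
    (tendsto_principal.2 (Eventually.of_forall hmemM))
  rw [mapClusterPt_iff_ultrafilter] at hν
  obtain ⟨U, hU, hUν⟩ := hν
  refine ⟨ν, inferInstance, ?_⟩
  intro ζ hζ
  rw [FiniteMeasure.tendsto_iff_forall_integral_tendsto] at hUν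
  have t1 := hUν (BoundedContinuousFunction.ofNormedAddCommGroup _ (poisson_cont hζ)
    (1 / (1 - ‖ζ‖) ^ 2) (fun θ => by
      rw [Real.norm_of_nonneg (poisson_bounds hζ θ).1]
      exact (poisson_bounds hζ θ).2))
  simp only [BoundedContinuousFunction.coe_ofNormedAddCommGroup] at t1
  have t2 : Tendsto (fun n => (H ((r n : ℂ) * ζ)).re) atTop (𝓝 (H ζ).re) := by
    have hc : ContinuousAt H ζ :=
      (hd.differentiableAt (Metric.isOpen_ball.mem_nhds (by simpa using hζ))).continuousAt
    have t3 : Tendsto (fun n => (r n : ℂ) * ζ) atTop (𝓝 ζ) := by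
      have := ((Complex.continuous_ofReal.tendsto 1).comp rt).mul_const ζ
      simpa using this
    exact (Complex.continuous_re.tendsto _).comp (hc.tendsto.comp t3)
  refine tendsto_nhds_unique t1 ((t2.mono_left hU).congr ?_)
  intro n
  exact (mint n ζ hζ).symm

lemma sub_ofReal_ne {z : ℂ} (hz : 0 < z.im) (t : ℝ) : z - (t : ℂ) ≠ 0 := by
  intro h
  have := congrArg Complex.im h
  simp at this
  linarith

lemma norm_inv_sub_le {z : ℂ} (hz : 0 < z.im) (t : ℝ) : ‖(z - (t : ℂ))⁻¹‖ ≤ 1 / z.im := by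
  rw [norm_inv, ← one_div]
  have := Complex.abs_im_le_norm (z - (t : ℂ))
  simp only [Complex.sub_im, Complex.ofReal_im, sub_zero] at this
  rw [abs_of_pos hz] at this
  gcongr

lemma integrable_cauchy (μ : Measure ℝ) [IsFiniteMeasure μ] {z : ℂ} (hz : 0 < z.im) :
    Integrable (fun t : ℝ => (z - (t : ℂ))⁻¹) μ := by
  refine Integrable.of_bound (C := 1 / z.im) ?_ (Eventually.of_forall (norm_inv_sub_le hz))
  apply Continuous.aestronglyMeasurable
  exact Continuous.inv₀ (by fun_prop) (sub_ofReal_ne hz)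

lemma norm_cauchyG_le (μ : Measure ℝ) [IsFiniteMeasure μ] {z : ℂ} (hz : 0 < z.im) :
    ‖cauchyG μ z‖ ≤ μ.real univ / z.im := by
  have := norm_integral_le_of_norm_le_const (μ := μ) (Eventually.of_forall (norm_inv_sub_le hz))
  unfold cauchyG
  refine this.trans (le_of_eq ?_)
  ring

lemma differentiableOn_cauchyG (μ : Measure ℝ) [IsFiniteMeasure μ] :
    DifferentiableOn ℂ (cauchyG μ) upperHalf := by
  have h1 := (analyticOn_resolventTransform (μ := μ)).differentiableOn
  have h2 : upperHalf ⊆ (algebraMap ℝ ℂ '' μ.support)ᶜ := by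
    rintro z hz ⟨t, -, rfl⟩
    simp [upperHalf] at hz
  refine ((h1.mono h2).neg).congr ?_
  intro z hz
  simp only [cauchyG, resolventTransform, resolvent, Pi.neg_apply]
  rw [← integral_neg]
  congr 1
  ext t
  rw [Ring.inverse_eq_inv', ← inv_neg, neg_sub]
  rfl

lemma im_inv_sub {z : ℂ} (t : ℝ) : ((z - (t : ℂ))⁻¹).im = -(z.im / ‖z - t‖ ^ 2) := by
  rw [Complex.inv_im, Complex.normSq_eq_norm_sq]
  simp [neg_div]

lemma poisson_half {z E : ℂ} (hz : 0 < z.im) (hE : ‖E‖ = 1) (hE1 : E ≠ 1) :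
    poissonKernel 0 ((z - I) / (z + I)) E =
      (1 + ((I * (1 + E) / (1 - E)).re) ^ 2) * (z.im / ‖z - (((I * (1 + E) / (1 - E)).re : ℝ) : ℂ)‖ ^ 2) := by
  have h1 : (1 - E) ≠ 0 := sub_ne_zero.2 (Ne.symm hE1)
  have hEn : E * conj E = 1 := by
    rw [Complex.mul_conj, Complex.normSq_eq_norm_sq, hE]; simp
  have hE0 : conj E ≠ 0 := by
    intro h0
    rw [h0] at hEn
    simp at hEn
  have h1' : (1 - conj E) ≠ 0 := by
    intro h0
    have := congrArg conj h0
    simp at this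
    exact h1 this
  have hreal : (((I * (1 + E) / (1 - E)).re : ℝ) : ℂ) = I * (1 + E) / (1 - E) := by
    rw [← Complex.conj_eq_iff_re]
    simp only [map_div₀, map_mul, map_add, map_sub, map_one, Complex.conj_I]
    rw [div_eq_div_iff h1' h1]
    linear_combination (2 * I) * hEn
  set T := (I * (1 + E) / (1 - E)).re with hT
  have hTI : (T : ℂ) + I ≠ 0 := by
    intro h0
    have := congrArg Complex.im h0
    simp at this
  have hzI : z + I ≠ 0 := by
    intro h0
    have := congrArg Complex.im h0
    simp at this
    linarith
  have hET : E = (T - I) / (T + I) := by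
    rw [eq_div_iff hTI, hreal]
    field_simp
    ring
  have hzT := sub_ofReal_ne hz T
  have e1 : E - (z - I) / (z + I) = 2 * I * (T - z) / ((T + I) * (z + I)) := by
    rw [hET]
    field_simp
    ring
  have nTI : ‖(T : ℂ) + I‖ ^ 2 = 1 + T ^ 2 := by
    rw [← Complex.normSq_eq_norm_sq, Complex.normSq_apply]; simp; ring
  have nn : ‖z + I‖ ^ 2 - ‖z - I‖ ^ 2 = 4 * z.im := by
    rw [← Complex.normSq_eq_norm_sq, ← Complex.normSq_eq_norm_sq, Complex.normSq_apply,
      Complex.normSq_apply]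
    simp; ring
  have hpz : 0 < ‖z + I‖ := norm_pos_iff.2 hzI
  have hpT : 0 < ‖(T : ℂ) + I‖ := norm_pos_iff.2 hTI
  have hpzT : 0 < ‖z - T‖ := norm_pos_iff.2 hzT
  unfold poissonKernel
  rw [sub_zero, sub_zero, hE, e1, norm_div, norm_div, norm_mul, norm_mul, norm_mul, norm_sub_rev (T : ℂ) z,
    ← nTI]
  simp only [Complex.norm_I, Complex.norm_ofNat]
  have : z.im = (‖z + I‖ ^ 2 - ‖z - I‖ ^ 2) / 4 := by rw [nn]; ring
  rw [this]
  field_simp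
  ring

lemma nevanlinna {G : ℂ → ℂ} (hd : DifferentiableOn ℂ G upperHalf)
    (hm : ∀ z ∈ upperHalf, (G z).im < 0) (hb : ∀ z ∈ upperHalf, ‖G z‖ ≤ 1 / z.im) :
    ∃ μ : Measure ℝ, μ univ ≤ 1 ∧ ∀ z ∈ upperHalf, G z = cauchyG μ z := by
  have hI : I ∈ upperHalf := by simp [upperHalf]
  set ψ : ℂ → ℂ := fun u => (I - conj I * u) / (1 - u) with hψ
  have hψm : ∀ u ∈ Metric.ball (0 : ℂ) 1, ψ u ∈ upperHalf := by
    intro u hu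
    exact im_psi I u (by simpa using hu) (by simp)
  have h1u : ∀ u ∈ Metric.ball (0 : ℂ) 1, 1 - u ≠ 0 := by
    intro u hu h
    have : u = 1 := by linear_combination -h
    rw [this] at hu
    simp at hu
  have hψd : DifferentiableOn ℂ ψ (Metric.ball 0 1) := by
    apply DifferentiableOn.div
    · fun_prop
    · fun_prop
    · exact h1u
  obtain ⟨ν, hνf, hν⟩ := herglotz (H := fun u => I * G (ψ u))
    ((hd.comp hψd hψm).const_mul I) (fun u hu => by
      have := hm _ (hψm u hu)
      simpa using this)
  have hzne : ∀ z ∈ upperHalf, z + I ≠ 0 := by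
    intro z hz h0
    have hz' : 0 < z.im := hz
    have := congrArg Complex.im h0
    simp at this
    linarith
  have hζn : ∀ z ∈ upperHalf, ‖(z - I) / (z + I)‖ < 1 := by
    intro z hz
    have hz' : 0 < z.im := hz
    rw [norm_div, div_lt_one (norm_pos_iff.2 (hzne z hz))]
    apply lt_of_pow_lt_pow_left₀ 2 (norm_nonneg _)
    have := norm_sub_conj_sq z I
    simp only [Complex.conj_I, sub_neg_eq_add, Complex.I_im] at this
    rw [this]
    linarith
  have hψζ : ∀ z ∈ upperHalf, ψ ((z - I) / (z + I)) = z := by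
    intro z hz
    have h1 := hzne z hz
    have h2 : 1 - (z - I) / (z + I) ≠ 0 := h1u _ (by simpa using hζn z hz)
    simp only [hψ]
    rw [div_eq_iff h2, Complex.conj_I]
    field_simp
    ring
  -- the lower integral identity on the circle
  have hL : ∀ z ∈ upperHalf, ∫⁻ θ, ENNReal.ofReal
      (poissonKernel 0 ((z - I) / (z + I)) (circleMap 0 1 θ)) ∂ν = ENNReal.ofReal (-(G z).im) := by
    intro z hz
    have h1 := hν _ (hζn z hz)
    rw [hψζ z hz] at h1
    have h2 : (I * G z).re = -(G z).im := by simp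
    rw [← h2, ← h1, ofReal_integral_eq_lintegral_ofReal]
    · refine Integrable.of_bound (C := 1 / (1 - ‖(z - I) / (z + I)‖) ^ 2)
        (poisson_cont (hζn z hz)).aestronglyMeasurable (Eventually.of_forall fun θ => ?_)
      rw [Real.norm_of_nonneg (poisson_bounds (hζn z hz) θ).1]
      exact (poisson_bounds (hζn z hz) θ).2
    · exact Eventually.of_forall fun θ => (poisson_bounds (hζn z hz) θ).1
  have hyu : ∀ y : ℝ, 0 < y → (y : ℂ) * I ∈ upperHalf := by
    intro y hy
    simpa [upperHalf] using hy
  have hGy : ∀ y : ℝ, 0 < y → -(G ((y : ℂ) * I)).im ≤ 1 / y := by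
    intro y hy
    have h1 := hb _ (hyu y hy)
    have h2 := Complex.abs_im_le_norm (G ((y : ℂ) * I))
    have h3 := (abs_le.1 (h2.trans h1)).1
    simp at h3
    simp
    linarith
  -- no mass at the point at infinity
  set S : Set ℝ := {θ | circleMap 0 1 θ = 1} with hS
  have hSm : MeasurableSet S :=
    (isClosed_eq (continuous_circleMap 0 1) continuous_const).measurableSet
  have hS0 : ν S = 0 := by
    have hle : ∀ n : ℕ, ENNReal.ofReal ((n : ℝ) + 1) * ν S ≤ 1 := by
      intro n
      have hy : (0 : ℝ) < n + 1 := by positivity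
      set y : ℝ := n + 1 with hydef
      have hz := hyu y hy
      have hP : ∀ θ ∈ S, poissonKernel 0 (((y : ℂ) * I - I) / ((y : ℂ) * I + I))
          (circleMap 0 1 θ) = y := by
        intro θ hθ
        have hθ' : circleMap 0 1 θ = 1 := hθ
        rw [hθ']
        have e : ((y : ℂ) * I - I) / ((y : ℂ) * I + I) = (((y - 1) / (y + 1) : ℝ) : ℂ) := by
          have : (y : ℂ) + 1 ≠ 0 := by
            have : (y + 1 : ℝ) ≠ 0 := by positivity
            exact_mod_cast this
          have h2 : (y : ℂ) * I + I ≠ 0 := hzne _ hz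
          push_cast
          rw [div_eq_div_iff h2 this]
          ring
        rw [e]
        unfold poissonKernel
        have e2 : (1 : ℂ) - 0 - ((((y - 1) / (y + 1) : ℝ) : ℂ) - 0)
          = ((1 - (y - 1) / (y + 1) : ℝ) : ℂ) := by push_cast; ring
        rw [e2, sub_zero, sub_zero, Complex.norm_real, Complex.norm_real, Real.norm_eq_abs,
          Real.norm_eq_abs, sq_abs, sq_abs, norm_one]
        have : (y + 1 : ℝ) ≠ 0 := by positivity
        have h3 : 1 - (y - 1) / (y + 1) = 2 / (y + 1) := by field_simp; ring
        rw [h3]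
        field_simp
        ring
      calc ENNReal.ofReal y * ν S = ∫⁻ θ in S, ENNReal.ofReal y ∂ν := by
            rw [setLIntegral_const]
        _ = ∫⁻ θ in S, ENNReal.ofReal (poissonKernel 0 (((y : ℂ) * I - I) / ((y : ℂ) * I + I))
          (circleMap 0 1 θ)) ∂ν := by
            apply setLIntegral_congr_fun hSm
            intro θ hθ
            simp only [hP θ hθ]
        _ ≤ _ := setLIntegral_le_lintegral _ _
        _ = ENNReal.ofReal (-(G ((y : ℂ) * I)).im) := hL _ hz
        _ ≤ ENNReal.ofReal 1 := by
            apply ENNReal.ofReal_le_ofReal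
            refine (hGy y hy).trans ?_
            rw [div_le_one hy, hydef]
            have : (0 : ℝ) ≤ n := by positivity
            linarith
        _ = 1 := by simp
    by_contra h0
    have hpos : 0 < ν.real S := by
      rw [measureReal_def]
      exact ENNReal.toReal_pos h0 (measure_ne_top _ _)
    obtain ⟨n, hn⟩ := exists_nat_gt (1 / ν.real S)
    have h1 := ENNReal.toReal_mono ENNReal.one_ne_top (hle n)
    rw [ENNReal.toReal_mul, ENNReal.toReal_ofReal (by positivity), ← measureReal_def] at h1
    rw [div_lt_iff₀ hpos] at hn
    simp at h1
    nlinarith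
  set T : ℝ → ℝ := fun θ => (I * (1 + circleMap 0 1 θ) / (1 - circleMap 0 1 θ)).re with hT
  have hTm : Measurable T := by
    have hc : Measurable (circleMap 0 1) := (continuous_circleMap 0 1).measurable
    exact Complex.measurable_re.comp (((hc.const_add 1).const_mul I).div (hc.const_sub 1))
  set μ : Measure ℝ := (ν.withDensity (fun θ => ENNReal.ofReal (1 + T θ ^ 2))).map T with hμ
  have hK : ∀ z ∈ upperHalf, ∫⁻ t : ℝ, ENNReal.ofReal (z.im / ‖z - (t : ℂ)‖ ^ 2) ∂μ
      = ENNReal.ofReal (-(G z).im) := by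
    intro z hz
    have hm1 : Measurable (fun t : ℝ => ENNReal.ofReal (z.im / ‖z - (t : ℂ)‖ ^ 2)) := by
      fun_prop
    have hm2 : Measurable (fun θ => ENNReal.ofReal (1 + T θ ^ 2)) := by fun_prop
    have hm3 : Measurable (fun θ => ENNReal.ofReal (z.im / ‖z - ((T θ : ℝ) : ℂ)‖ ^ 2)) :=
      hm1.comp hTm
    rw [hμ, lintegral_map hm1 hTm, lintegral_withDensity_eq_lintegral_mul _ hm2 hm3,
      ← hL z hz]
    apply lintegral_congr_ae
    have hae : ∀ᵐ θ ∂ν, θ ∉ S := measure_eq_zero_iff_ae_notMem.1 hS0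
    filter_upwards [hae] with θ hθ
    rw [poisson_half hz (by simp) hθ, ENNReal.ofReal_mul (by positivity)]
    rfl
  have hμ1 : μ univ ≤ 1 := by
    set f : ℕ → ℝ → ENNReal := fun n t =>
      ENNReal.ofReal ((n : ℝ) + 1) * ENNReal.ofReal (((n : ℝ) + 1) / ‖(((n : ℝ) + 1 : ℝ) : ℂ) * I - (t : ℂ)‖ ^ 2)
      with hf
    have hfm : ∀ n, Measurable (f n) := by
      intro n
      simp only [hf]
      fun_prop
    have hfi : ∀ n, ∫⁻ t, f n t ∂μ ≤ 1 := by
      intro n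
      have hy : (0 : ℝ) < n + 1 := by positivity
      simp only [hf]
      rw [lintegral_const_mul _ (by fun_prop)]
      have h1 := hK _ (hyu _ hy)
      have h2 : ((((n : ℝ) + 1 : ℝ) : ℂ) * I).im = (n : ℝ) + 1 := by simp
      rw [h2] at h1
      rw [h1, ← ENNReal.ofReal_mul hy.le, ← ENNReal.ofReal_one]
      apply ENNReal.ofReal_le_ofReal
      have h3 := mul_le_mul_of_nonneg_left (hGy _ hy) hy.le
      rwa [mul_one_div_cancel hy.ne'] at h3
    have hfl : ∀ t, Tendsto (fun n => f n t) atTop (𝓝 1) := by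
      intro t
      have e : ∀ n : ℕ, f n t = ENNReal.ofReal (1 / (1 + t ^ 2 * (1 / ((n : ℝ) + 1)) ^ 2)) := by
        intro n
        have hy : (0 : ℝ) < n + 1 := by positivity
        simp only [hf]
        rw [← ENNReal.ofReal_mul hy.le]
        congr 1
        have h3 : ‖(((n : ℝ) + 1 : ℝ) : ℂ) * I - (t : ℂ)‖ ^ 2 = ((n : ℝ) + 1) ^ 2 + t ^ 2 := by
          rw [← Complex.normSq_eq_norm_sq, Complex.normSq_apply]
          simp
          ring
        rw [h3]
        field_simp
      simp only [e]
      rw [← ENNReal.ofReal_one]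
      apply ENNReal.tendsto_ofReal
      have h4 : Tendsto (fun n : ℕ => 1 / (1 + t ^ 2 * (1 / ((n : ℝ) + 1)) ^ 2)) atTop
          (𝓝 (1 / (1 + t ^ 2 * 0 ^ 2))) := by
        apply Tendsto.div tendsto_const_nhds
        · exact ((tendsto_one_div_add_atTop_nhds_zero_nat.pow 2).const_mul _).const_add _
        · simp
      simpa using h4
    calc μ univ = ∫⁻ t, liminf (fun n => f n t) atTop ∂μ := by
          simp only [(hfl _).liminf_eq]
          simp
      _ ≤ liminf (fun n => ∫⁻ t, f n t ∂μ) atTop := lintegral_liminf_le hfm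
      _ ≤ liminf (fun _ : ℕ => (1 : ENNReal)) atTop := by
          exact liminf_le_liminf (Eventually.of_forall hfi)
      _ = 1 := by simp
  have : IsFiniteMeasure μ := ⟨lt_of_le_of_lt hμ1 ENNReal.one_lt_top⟩
  have hreal1 : μ.real univ ≤ 1 := by
    have := ENNReal.toReal_mono ENNReal.one_ne_top hμ1
    simpa [measureReal_def] using this
  refine ⟨μ, hμ1, ?_⟩
  have him : ∀ z ∈ upperHalf, (cauchyG μ z).im = (G z).im := by
    intro z hz
    have hz' : 0 < z.im := hz
    have h1 := integral_im (integrable_cauchy μ hz')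
    change ∫ t : ℝ, ((z - (t : ℂ))⁻¹).im ∂μ = (cauchyG μ z).im at h1
    rw [← h1]
    simp only [im_inv_sub]
    rw [integral_neg, integral_eq_lintegral_of_nonneg_ae, hK z hz,
      ENNReal.toReal_ofReal (by linarith [hm z hz]), neg_neg]
    · exact Eventually.of_forall fun t => by positivity
    · apply Measurable.aestronglyMeasurable
      fun_prop
  set D : ℂ → ℂ := fun z => G z - cauchyG μ z with hD
  have hDa : AnalyticOnNhd ℂ D upperHalf :=
    (hd.sub (differentiableOn_cauchyG μ)).analyticOnNhd isOpen_upperHalf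
  have hconn : IsPreconnected upperHalf := (convex_halfSpace_im_gt 0).isPreconnected
  have hDim : ∀ z ∈ upperHalf, (D z).im = 0 := by
    intro z hz
    simp [hD, him z hz]
  obtain ⟨d, hd0⟩ | hopen := hDa.is_constant_or_isOpen hconn
  · have hdn : ∀ y : ℝ, 0 < y → ‖d‖ ≤ 2 / y := by
      intro y hy
      have hz := hyu y hy
      have him : ((y : ℂ) * I).im = y := by simp
      rw [← hd0 _ hz]
      have h1 := hb _ hz
      have h2 := norm_cauchyG_le μ (z := (y : ℂ) * I) hz
      rw [him] at h1 h2
      have h3 : μ.real univ / y ≤ 1 / y := by gcongr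
      calc ‖D (y * I)‖ ≤ ‖G (y * I)‖ + ‖cauchyG μ (y * I)‖ := norm_sub_le _ _
        _ ≤ 1 / y + 1 / y := by linarith
        _ = 2 / y := by ring
    have hd00 : d = 0 := by
      by_contra hne
      have hp : 0 < ‖d‖ := norm_pos_iff.2 hne
      have := hdn (4 / ‖d‖) (by positivity)
      have e : 2 / (4 / ‖d‖) = ‖d‖ / 2 := by field_simp; norm_num
      rw [e] at this
      linarith
    intro z hz
    have := hd0 z hz
    rw [hd00] at this
    exact sub_eq_zero.1 this
  · exfalso
    have ho := hopen upperHalf subset_rfl isOpen_upperHalf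
    have hmem : D I ∈ D '' upperHalf := ⟨I, hI, rfl⟩
    obtain ⟨δ, hδ, hball⟩ := Metric.isOpen_iff.1 ho _ hmem
    have : D I + ((δ / 2 : ℝ) : ℂ) * I ∈ Metric.ball (D I) δ := by
      rw [Metric.mem_ball, dist_eq_norm, add_sub_cancel_left, norm_mul, Complex.norm_I,
        Complex.norm_real, Real.norm_of_nonneg (by positivity)]
      linarith
    obtain ⟨z, hz, hze⟩ := hball this
    have h1 := hDim z hz
    rw [hze, Complex.add_im, hDim I hI, Complex.im_ofReal_mul] at h1
    simp at h1
    linarith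

lemma small {g : ℂ → ℂ} (hg : DifferentiableOn ℂ g upperHalf)
    (hmap : ∀ z ∈ upperHalf, (g z).im < 0)
    (hliminf : Filter.liminf (fun y : ℝ => ‖g ((y : ℂ) * Complex.I)‖ / y) Filter.atTop = 0) :
    ∀ ε > 0, ∃ᶠ y : ℝ in atTop, ‖g ((y : ℂ) * I)‖ < ε * y := by
  intro ε hε hcon
  have hI : I ∈ upperHalf := by simp [upperHalf]
  have hbd : ∀ y : ℝ, 1 ≤ y → ‖g ((y : ℂ) * I)‖ / y ≤ 4 * ‖g I‖ := by
    intro y hy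
    have hy0 : 0 < y := by linarith
    have hyI : (y : ℂ) * I ∈ upperHalf := by simp [upperHalf, hy0]
    have hsp := schwarz_pick (h := fun z => -g z) hg.neg
      (fun z hz => by simpa using hmap z hz) hyI hI
    have e1 : (-g ((y : ℂ) * I)) - (-g I) = -(g ((y : ℂ) * I) - g I) := by ring
    have e2 : (y : ℂ) * I - I = ((y - 1 : ℝ) : ℂ) * I := by push_cast; ring
    simp only [e1, norm_neg, e2, norm_mul, norm_I, mul_one, norm_real, neg_im] at hsp
    have e3 : ((y : ℂ) * I).im = y := by simp
    rw [e3, I_im, mul_one, Real.norm_eq_abs, sq_abs] at hsp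
    have i1 : -(g ((y : ℂ) * I)).im ≤ ‖g ((y : ℂ) * I)‖ :=
      (neg_le_abs _).trans (abs_im_le_norm _)
    have i2 : -(g I).im ≤ ‖g I‖ := (neg_le_abs _).trans (abs_im_le_norm _)
    have i3 := hmap _ hyI
    have i4 := hmap _ hI
    have tri : ‖g ((y : ℂ) * I)‖ - ‖g I‖ ≤ ‖g ((y : ℂ) * I) - g I‖ := norm_sub_norm_le _ _
    have hprod : -(g ((y : ℂ) * I)).im * -(g I).im ≤ ‖g ((y : ℂ) * I)‖ * ‖g I‖ :=
      mul_le_mul i1 i2 (by linarith) (norm_nonneg _)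
    generalize ‖g ((y : ℂ) * I) - g I‖ = D at *
    have hX0 := norm_nonneg (g ((y : ℂ) * I))
    have hA0 := norm_nonneg (g I)
    generalize ‖g ((y : ℂ) * I)‖ = X at *
    generalize ‖g I‖ = A at *
    rw [div_le_iff₀ hy0]
    by_contra hlt
    push Not at hlt
    have hXA : 2 * A < X := by nlinarith
    have hD : X / 2 ≤ D := by linarith
    have h1 : (X / 2) ^ 2 * y ≤ y ^ 2 * (X * A) := by
      calc (X / 2) ^ 2 * y ≤ D ^ 2 * y := by gcongr
        _ ≤ (y - 1) ^ 2 * (-(g ((y : ℂ) * I)).im * -(g I).im) := hsp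
        _ ≤ y ^ 2 * (X * A) := by
          apply mul_le_mul _ hprod _ (by positivity)
          · nlinarith
          · exact mul_nonneg (by linarith) (by linarith)
    have hXp : 0 < X * y := mul_pos (by linarith) hy0
    have : X * y * (X - 4 * A * y) ≤ 0 := by nlinarith
    have : 0 < X * y * (X - 4 * A * y) := mul_pos hXp (by linarith)
    linarith
  have hB : IsBoundedUnder (· ≤ ·) atTop (fun y : ℝ => ‖g ((y : ℂ) * I)‖ / y) :=
    ⟨4 * ‖g I‖, by
      rw [eventually_map]
      filter_upwards [eventually_ge_atTop 1] with y hy using hbd y hy⟩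
  have : ε ≤ Filter.liminf (fun y : ℝ => ‖g ((y : ℂ) * Complex.I)‖ / y) Filter.atTop := by
    apply le_liminf_of_le hB.isCoboundedUnder_ge
    filter_upwards [hcon, eventually_gt_atTop 0] with y hy hy0
    rw [le_div_iff₀ hy0]
    exact not_lt.mp hy
  linarith

lemma inverse_differentiable {h F : ℂ → ℂ} (hd : DifferentiableOn ℂ h upperHalf)
    (hm : ∀ z ∈ upperHalf, 0 < (h z).im)
    (hF : ∀ w ∈ upperHalf, F w ∈ upperHalf ∧ F w = w + h (F w)) :
    DifferentiableOn ℂ F upperHalf := by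
  intro w hw
  obtain ⟨hz, ez⟩ := hF w hw
  set z := F w with hzdef
  have hlt : (h z).im < z.im := by
    have := congrArg im ez
    rw [add_im] at this
    have hw' : 0 < w.im := hw
    linarith
  have hne := deriv_ne_one hd hm hz hlt
  have han : AnalyticAt ℂ h z := hd.analyticAt (isOpen_upperHalf.mem_nhds hz)
  have hs : HasStrictDerivAt (fun x => x - h x) (1 - deriv h z) z :=
    (hasStrictDerivAt_id z).sub han.hasStrictDerivAt
  have hne' : 1 - deriv h z ≠ 0 := sub_ne_zero.mpr (Ne.symm hne)
  have efz : z - h z = w := by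
    nth_rewrite 1 [ez]; ring
  have hl := hs.to_localInverse hne'
  have hs' := hs.hasStrictFDerivAt_equiv hne'
  have hr := hs'.eventually_right_inverse
  have hc : Tendsto (hs.localInverse _ _ _ hne') (𝓝 (z - h z)) (𝓝 z) := hs'.localInverse_tendsto
  rw [efz] at hl hr hc
  refine (hl.hasDerivAt.differentiableAt.congr_of_eventuallyEq ?_).differentiableWithinAt
  filter_upwards [hr, hc.eventually (isOpen_upperHalf.mem_nhds hz),
    isOpen_upperHalf.mem_nhds hw] with v hv1 hv2 hv3
  obtain ⟨a, b⟩ := hF v hv3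
  refine fixed_unique hd hm hv3 a hv2 b ?_
  exact (sub_eq_iff_eq_add.mp hv1)

end MaassenAux

/-- Lemma 4.1: if g : ℂ⁺ → ℂ⁻ is analytic with liminf_{y→∞} |g(iy)|/y = 0, then
z ↦ z + g(z) takes every value of ℂ⁺ exactly once, and the inverse is in the class 𝓕. -/
theorem maassen_type_inverse (g : ℂ → ℂ)
    (hg : DifferentiableOn ℂ g upperHalf)
    (hmap : ∀ z ∈ upperHalf, (g z).im < 0)
    (hliminf : Filter.liminf (fun y : ℝ => ‖g ((y : ℂ) * Complex.I)‖ / y) Filter.atTop = 0) :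
    (∀ w ∈ upperHalf, ∃! z : ℂ, z ∈ upperHalf ∧ z + g z = w) ∧
    ∃ finv : ℂ → ℂ, classF finv ∧
      ∀ w ∈ upperHalf, finv w ∈ upperHalf ∧ finv w + g (finv w) = w := by
  have hsm := MaassenAux.small hg hmap hliminf
  have hd : DifferentiableOn ℂ (fun z => -g z) upperHalf := hg.neg
  have hm : ∀ z ∈ upperHalf, 0 < ((fun z => -g z) z).im := fun z hz => by simpa using hmap z hz
  have hex : ∀ w ∈ upperHalf, ∃ z ∈ upperHalf, z = w + (fun z => -g z) z := fun w hw =>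
    MaassenAux.exists_fixed hd hm (by simpa only [norm_neg] using hsm) hw
  have hun : ∀ w ∈ upperHalf, ∀ z ∈ upperHalf, ∀ ζ ∈ upperHalf, z + g z = w → ζ + g ζ = w →
      z = ζ := by
    intro w hw z hz ζ hζ e1 e2
    exact MaassenAux.fixed_unique hd hm hw hz hζ (by rw [← e1]; simp) (by rw [← e2]; simp)
  have hfe : ∀ z w : ℂ, z = w + (fun z => -g z) z → z + g z = w := by
    intro z w e
    have e' : z = w + -g z := e
    linear_combination e'
  choose! F hFu hFe using hex
  have hFe' : ∀ w ∈ upperHalf, F w + g (F w) = w := fun w hw => hfe _ _ (hFe w hw)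
  refine ⟨fun w hw => ⟨F w, ⟨hFu w hw, hFe' w hw⟩, fun z hz =>
    hun w hw z hz.1 _ (hFu w hw) hz.2 (hFe' w hw)⟩, F, ?_, fun w hw => ⟨hFu w hw, hFe' w hw⟩⟩
  have hFd : DifferentiableOn ℂ F upperHalf :=
    MaassenAux.inverse_differentiable hd hm (fun w hw => ⟨hFu w hw, hFe w hw⟩)
  have hF0 : ∀ w ∈ upperHalf, F w ≠ 0 := by
    intro w hw h0
    have : 0 < (F w).im := hFu w hw
    simp [h0] at this
  have hFim : ∀ w ∈ upperHalf, w.im ≤ (F w).im := by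
    intro w hw
    have e := congrArg im (hFe' w hw)
    rw [add_im] at e
    have := hmap _ (hFu w hw)
    linarith
  obtain ⟨μ, hμ1, hμ⟩ := MaassenAux.nevanlinna (G := fun w => (F w)⁻¹)
    (hFd.inv hF0)
    (by
      intro w hw
      have h1 : 0 < (F w).im := hFu w hw
      rw [inv_im]
      have := normSq_pos.mpr (hF0 w hw)
      exact div_neg_of_neg_of_pos (by linarith) this)
    (by
      intro w hw
      have hw' : 0 < w.im := hw
      rw [norm_inv, ← one_div]
      apply one_div_le_one_div_of_le hw'
      exact (hFim w hw).trans ((le_abs_self _).trans (abs_im_le_norm _)))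
  have hfin : IsFiniteMeasure μ := ⟨lt_of_le_of_lt hμ1 ENNReal.one_lt_top⟩
  have hge : 1 ≤ μ.real univ := by
    apply le_of_forall_pos_lt_add
    intro ε hε
    obtain ⟨y, hy, hy0⟩ := ((hsm (ε / 2) (by linarith)).and_eventually
      (eventually_gt_atTop 0)).exists
    by_cases hε1 : 1 < ε
    · have : 0 ≤ μ.real univ := measureReal_nonneg
      linarith
    have hyI : (y : ℂ) * I ∈ upperHalf := by simp [upperHalf, hy0]
    have him : (1 - ε / 2) * y ≤ ((y : ℂ) * I + g ((y : ℂ) * I)).im := by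
      have i1 : -(g ((y : ℂ) * I)).im ≤ ‖g ((y : ℂ) * I)‖ :=
        (neg_le_abs _).trans (abs_im_le_norm _)
      have e3 : ((y : ℂ) * I).im = y := by simp
      rw [add_im, e3]
      linarith
    have hpos : 0 < (1 - ε / 2) * y := mul_pos (by linarith) hy0
    have hw : (y : ℂ) * I + g ((y : ℂ) * I) ∈ upperHalf := lt_of_lt_of_le hpos him
    have hFy : F ((y : ℂ) * I + g ((y : ℂ) * I)) = (y : ℂ) * I :=
      hun _ hw _ (hFu _ hw) _ hyI (hFe' _ hw) rfl
    have hb := MaassenAux.norm_cauchyG_le μ (z := (y : ℂ) * I + g ((y : ℂ) * I)) hw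
    rw [← hμ _ hw] at hb
    simp only [hFy, norm_inv, norm_mul, norm_I, mul_one, norm_real, Real.norm_eq_abs,
      abs_of_pos hy0] at hb
    have hw' : 0 < ((y : ℂ) * I + g ((y : ℂ) * I)).im := hw
    rw [le_div_iff₀ hw'] at hb
    have h2 : y⁻¹ * ((1 - ε / 2) * y) ≤ μ.real univ :=
      (mul_le_mul_of_nonneg_left him (by positivity)).trans hb
    have h3 : y⁻¹ * ((1 - ε / 2) * y) = 1 - ε / 2 := by field_simp
    linarith
  refine ⟨μ, ⟨le_antisymm hμ1 ?_⟩, fun w hw => ?_⟩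
  · have h := ENNReal.ofReal_le_ofReal hge
    rwa [ENNReal.ofReal_one, ofReal_measureReal] at h
  · rw [recF, ← hμ w hw, inv_inv]
end
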